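/- arXiv:2409.09880 — 3 statements merged into one kernel-verified Lean document; each statement's English description precedes it below -/
import Mathlib

section
/- Let K ⊂ ℝ² be any compact set and let u ∈ C_c^2(ℝ²;ℝ²) satisfy div u = 0. Suppose that u(x) = 0 and ∇u(x) = 0 for every x ∈ K. Then there exists a sequence {u_k} ⊂ C_c^∞(ℝ²;ℝ²) with div u_k = 0 and supp u_k ⊂ ℝ² ∖ K, such that u_k → u in the C^1 norm. -/
open MeasureTheory Filter Topology Metric Set
open scoped ENNReal NNReal Classical

noncomputable section

namespace DFA

abbrev Euc (n : ℕ) := EuclideanSpace ℝ (Fin n)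
abbrev E2 := EuclideanSpace ℝ (Fin 2)

/-- `div u = 0` in the classical pointwise sense. -/
def divFree (u : E2 → E2) : Prop :=
  ∀ x, ∑ i, fderiv ℝ u x (EuclideanSpace.single i 1) i = 0

/-- A fixed standard mollifier. -/
def phiBump : ContDiffBump (0 : E2) := ⟨1/2, 1, by norm_num, by norm_num⟩

def phi : E2 → ℝ := phiBump.normed volume

lemma phi_smooth : ContDiff ℝ (⊤ : ℕ∞) phi := phiBump.contDiff_normed
lemma phi_cont : Continuous phi := phiBump.continuous_normed
lemma phi_supp : HasCompactSupport phi := phiBump.hasCompactSupport_normed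
lemma phi_nonneg (x : E2) : 0 ≤ phi x := phiBump.nonneg_normed x
lemma phi_int : ∫ x, phi x = 1 := phiBump.integral_normed
lemma phi_integrable : Integrable phi := phiBump.integrable_normed
lemma phi_zero {x : E2} (hx : x ∉ closedBall (0 : E2) 1) : phi x = 0 := by
  by_contra h
  apply hx
  have : x ∈ Function.support phi := h
  unfold phi at this
  rw [ContDiffBump.support_normed_eq] at this
  exact ball_subset_closedBall this

def mol {F : Type} [NormedAddCommGroup F] [NormedSpace ℝ F] (δ : ℝ) (g : E2 → F) (x : E2) : F :=
  ∫ y, phi y • g (x - δ • y)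

lemma conv_bound (n : ℕ) : ∀ (F : Type) [NormedAddCommGroup F] [NormedSpace ℝ F]
    [CompleteSpace F] (k : E2 → F), ContDiff ℝ (⊤ : ℕ∞) k →
    (∀ x, x ∉ closedBall (0 : E2) 1 → k x = 0) →
    ∃ C, 0 ≤ C ∧ ∀ (G : E2 → ℝ), LocallyIntegrable G → ∀ (z : E2) (A : ℝ), 
      (∀ y ∈ closedBall z 1, |G y| ≤ A) →
      ‖iteratedFDeriv ℝ n (fun z => ∫ t, G t • k (z - t)) z‖ ≤ C * A := by
  induction n with
  | zero =>
    intro F _ _ _ k hk hk0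
    have hcs : HasCompactSupport k := HasCompactSupport.intro (isCompact_closedBall _ _) hk0
    refine ⟨∫ t, ‖k t‖, by positivity, ?_⟩
    intro G hG z A hA
    rw [norm_iteratedFDeriv_zero]
    have hint : Integrable (fun t => ‖k t‖) := 
      (hk.continuous.integrable_of_hasCompactSupport hcs).norm
    calc ‖∫ t, G t • k (z - t)‖ ≤ ∫ t, A * ‖k (z - t)‖ := by
          apply norm_integral_le_of_norm_le
          · exact (hint.comp_sub_left z).const_mul A
          · refine Eventually.of_forall fun t => ?_
            rw [norm_smul]
            by_cases ht : z - t ∈ closedBall (0 : E2) 1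
            · apply mul_le_mul_of_nonneg_right _ (norm_nonneg _)
              apply hA
              rw [mem_closedBall, dist_comm, dist_eq_norm]
              simpa using ht
            · rw [hk0 _ ht]; simp
      _ = _ := by
          rw [integral_const_mul, mul_comm]
          congr 1
          exact integral_sub_left_eq_self (fun t => ‖k t‖) volume z
  | succ n ih =>
    intro F _ _ _ k hk hk0
    have hcs : HasCompactSupport k := HasCompactSupport.intro (isCompact_closedBall _ _) hk0
    have hk' : ContDiff ℝ (⊤ : ℕ∞) (fderiv ℝ k) := hk.fderiv_right (by simp)
    obtain ⟨C, hC, h⟩ := ih (E2 →L[ℝ] F) (fderiv ℝ k) hk' (by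
      intro x hx
      have : x ∉ tsupport k := by
        intro hx'
        apply hx
        refine closure_minimal ?_ isClosed_closedBall hx'
        intro y hy
        by_contra h
        exact hy (hk0 y h)
      exact image_eq_zero_of_notMem_tsupport (fun h => this (tsupport_fderiv_subset ℝ h)))
    refine ⟨C, hC, ?_⟩
    intro G hG z A hA
    rw [← norm_iteratedFDeriv_fderiv]
    have : fderiv ℝ (fun z => ∫ t, G t • k (z - t)) = fun z => ∫ t, G t • fderiv ℝ k (z - t) := by
      funext z
      have := hcs.hasFDerivAt_convolution_right (ContinuousLinearMap.lsmul ℝ ℝ) hG 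
        (hk.of_le (by norm_cast)) z
      have h2 := this.fderiv
      exact h2
    rw [this]
    exact h G hG z A hA

lemma mol_eq {δ : ℝ} (hδ : 0 < δ) (g : E2 → ℝ) :
    mol δ g = fun x => (fun z => ∫ t, g (δ • t) • phi (z - t)) (δ⁻¹ • x) := by
  funext x
  unfold mol
  have := integral_sub_left_eq_self (fun t => phi t • g (x - δ • t)) volume (δ⁻¹ • x)
  rw [← this]
  congr 1
  funext t
  rw [smul_sub, smul_inv_smul₀ hδ.ne', sub_sub_cancel, smul_eq_mul, smul_eq_mul, mul_comm]

lemma locInt_scale {δ : ℝ} (hδ : 0 < δ) {g : E2 → ℝ} (hg : LocallyIntegrable g) :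
    LocallyIntegrable (fun t => g (δ • t)) := by
  rw [locallyIntegrable_iff] at hg ⊢
  intro k hk
  have h := hg _ (hk.image (continuous_const_smul δ))
  rw [← integrable_indicator_iff (hk.image (continuous_const_smul δ)).measurableSet] at h
  rw [← integrable_indicator_iff hk.measurableSet]
  have := (integrable_comp_smul_iff volume (((fun x : E2 => δ • x) '' k).indicator g) hδ.ne').2 h
  refine this.congr (Eventually.of_forall fun t => ?_)
  symm
  by_cases ht : t ∈ k
  · simp only [indicator_of_mem ht]
    rw [indicator_of_mem (mem_image_of_mem _ ht)]
  · simp only [indicator_of_notMem ht]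
    rw [indicator_of_notMem]
    rintro ⟨s, hs, hst⟩
    exact ht ((smul_right_injective E2 hδ.ne' hst) ▸ hs)

lemma mol_smooth {δ : ℝ} (hδ : 0 < δ) {g : E2 → ℝ} (hg : LocallyIntegrable g) :
    ContDiff ℝ (⊤ : ℕ∞) (mol δ g) := by
  rw [mol_eq hδ]
  have : ContDiff ℝ (⊤ : ℕ∞) (fun z => ∫ t, g (δ • t) • phi (z - t)) :=
    phi_supp.contDiff_convolution_right (ContinuousLinearMap.lsmul ℝ ℝ) (locInt_scale hδ hg)
      phi_smooth
  exact this.comp (contDiff_const_smul _)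

/-- The basic estimate for derivatives of mollified functions. -/
lemma mol_bound : ∃ C, 0 ≤ C ∧ ∀ n : ℕ, n ≤ 2 → ∀ δ : ℝ, 0 < δ → ∀ g : E2 → ℝ, LocallyIntegrable g →
    ∀ (x : E2) (A : ℝ), 0 ≤ A → (∀ y ∈ closedBall x δ, |g y| ≤ A) →
      ‖iteratedFDeriv ℝ n (mol δ g) x‖ ≤ C * A * (δ⁻¹) ^ n := by
  choose C hC h using fun n => conv_bound n ℝ phi phi_smooth (fun x hx => phi_zero hx)
  refine ⟨C 0 + C 1 + C 2, by linarith [hC 0, hC 1, hC 2], ?_⟩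
  intro n hn δ hδ g hg x A hA0 hA
  have hsm : ContDiff ℝ (⊤ : ℕ∞) (fun z => ∫ t, g (δ • t) • phi (z - t)) :=
    phi_supp.contDiff_convolution_right (ContinuousLinearMap.lsmul ℝ ℝ) (locInt_scale hδ hg)
      phi_smooth
  have h1 := h n (fun t => g (δ • t)) (locInt_scale hδ hg) (δ⁻¹ • x) A (by
    intro y hy
    apply hA
    rw [mem_closedBall, dist_eq_norm] at hy ⊢
    have : δ • y - x = δ • (y - δ⁻¹ • x) := by rw [smul_sub, smul_inv_smul₀ hδ.ne']
    rw [this, norm_smul, Real.norm_of_nonneg hδ.le]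
    nlinarith)
  rw [mol_eq hδ, iteratedFDeriv_comp_const_smul _ (hsm.of_le (by norm_cast; exact le_top))]
  simp only
  rw [norm_smul, norm_pow, Real.norm_of_nonneg (inv_pos.2 hδ).le, mul_comm]
  apply mul_le_mul_of_nonneg_right _ (by positivity)
  refine h1.trans (mul_le_mul_of_nonneg_right ?_ hA0)
  interval_cases n <;> linarith [hC 0, hC 1, hC 2]

lemma phi_mol_integrable {F : Type} [NormedAddCommGroup F] [NormedSpace ℝ F] {g : E2 → F} 
    (hg : Continuous g) (δ : ℝ) (x : E2) :
    Integrable (fun y => phi y • g (x - δ • y)) := by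
  apply Continuous.integrable_of_hasCompactSupport
  · exact phi_cont.smul (hg.comp (by fun_prop))
  · exact phi_supp.smul_right

lemma mol_const {δ : ℝ} (a : ℝ) (x : E2) : mol δ (fun _ => a) x = a := by
  unfold mol
  rw [integral_smul_const, phi_int, one_smul]

lemma mol_sub {F : Type} [NormedAddCommGroup F] [NormedSpace ℝ F] {f g : E2 → F} 
    (hf : Continuous f) (hg : Continuous g) (δ : ℝ) (x : E2) :
    mol δ (fun y => f y - g y) x = mol δ f x - mol δ g x := by
  unfold mol
  rw [← integral_sub (phi_mol_integrable hf δ x) (phi_mol_integrable hg δ x)]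
  simp only [smul_sub]

lemma mol_congr {F : Type} [NormedAddCommGroup F] [NormedSpace ℝ F] {δ : ℝ} (hδ : 0 < δ)
    {f g : E2 → F} {x : E2} (h : ∀ y ∈ closedBall x δ, f y = g y) : mol δ f x = mol δ g x := by
  unfold mol
  congr 1
  funext y
  by_cases hy : y ∈ closedBall (0 : E2) 1
  · rw [h]
    rw [mem_closedBall, dist_eq_norm] at hy ⊢
    simp only [sub_sub_cancel_left, norm_neg, norm_smul, Real.norm_of_nonneg hδ.le]
    simp only [sub_zero] at hy
    nlinarith
  · rw [phi_zero hy, zero_smul, zero_smul]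

lemma mol_close {F : Type} [NormedAddCommGroup F] [NormedSpace ℝ F] [CompleteSpace F] {δ : ℝ} (hδ : 0 < δ)
    {g : E2 → F} (hg : Continuous g) {x : E2} {A : ℝ} (h : ∀ y ∈ closedBall x δ, ‖g y - g x‖ ≤ A) : 
    ‖mol δ g x - g x‖ ≤ A := by
  have h1 : mol δ g x - g x = ∫ y, phi y • (g (x - δ • y) - g x) := by
    simp only [smul_sub]
    rw [integral_sub (phi_mol_integrable hg δ x) (phi_integrable.smul_const _), 
      integral_smul_const, phi_int, one_smul]
    rfl
  rw [h1]
  calc _ ≤ ∫ y, phi y * A := by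
        apply norm_integral_le_of_norm_le (phi_integrable.mul_const _)
        refine Eventually.of_forall fun y => ?_
        rw [norm_smul, Real.norm_of_nonneg (phi_nonneg y)]
        by_cases hy : y ∈ closedBall (0 : E2) 1
        · apply mul_le_mul_of_nonneg_left _ (phi_nonneg y)
          apply h
          rw [mem_closedBall, dist_eq_norm] at hy ⊢
          simp only [sub_sub_cancel_left, norm_neg, norm_smul, Real.norm_of_nonneg hδ.le]
          simp only [sub_zero] at hy
          nlinarith
        · rw [phi_zero hy]; simp
    _ = A := by rw [integral_mul_const, phi_int, one_mul]

lemma mol_deriv {F : Type} [NormedAddCommGroup F] [NormedSpace ℝ F] [CompleteSpace F] (δ : ℝ)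
    {g : E2 → F} (hg : ContDiff ℝ 1 g) {M : ℝ} (hM : ∀ x, ‖fderiv ℝ g x‖ ≤ M) (x : E2) :
    HasFDerivAt (mol δ g) (mol δ (fderiv ℝ g) x) x := by
  unfold mol
  have hc : Continuous (fderiv ℝ g) := hg.continuous_fderiv (by simp)
  apply hasFDerivAt_integral_of_dominated_of_fderiv_le (s := univ) (bound := fun y => phi y * M)
    (F := fun x y => phi y • g (x - δ • y)) (F' := fun x y => phi y • fderiv ℝ g (x - δ • y))
  · exact univ_mem
  · exact Eventually.of_forall fun x => (phi_mol_integrable hg.continuous δ x).aestronglyMeasurable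
  · exact phi_mol_integrable hg.continuous δ x
  · exact (phi_mol_integrable hc δ x).aestronglyMeasurable
  · refine Eventually.of_forall fun y x _ => ?_
    rw [norm_smul, Real.norm_of_nonneg (phi_nonneg y)]
    exact mul_le_mul_of_nonneg_left (hM _) (phi_nonneg y)
  · exact phi_integrable.mul_const _
  · refine Eventually.of_forall fun y x _ => ?_
    have := ((hg.differentiable (by simp)) (x - δ • y)).hasFDerivAt
    have h2 := this.comp x ((hasFDerivAt_id x).sub_const (δ • y))
    exact h2.const_smul (phi y)

lemma exists_h (S : Set ℝ) (hS : volume S = 0) {ε : ℝ} (hε : 0 < ε) :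
    ∃ (U : Set ℝ) (h : ℝ → ℝ), IsOpen U ∧ S ⊆ U ∧ (∀ s t, |h s - h t| ≤ |s - t|) ∧
      (∀ t, |h t - t| ≤ ε) ∧ (∀ s t, s ≤ t → Icc s t ⊆ U → h s = h t) := by
  obtain ⟨U, hSU, hU, hvol⟩ := S.exists_isOpen_lt_of_lt (μ := volume) (ENNReal.ofReal ε)
    (by rw [hS]; simpa using hε)
  have hfin : ∀ V : Set ℝ, volume (U ∩ V) ≠ ⊤ := fun V =>
    ((measure_mono inter_subset_left).trans_lt (hvol.trans ENNReal.ofReal_lt_top)).ne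
  have hadd : ∀ s t : ℝ, s ≤ t → (volume.real (U ∩ Iic t)) = volume.real (U ∩ Iic s)
      + volume.real (U ∩ Ioc s t) := by
    intro s t hst
    rw [← measureReal_union]
    · rw [← inter_union_distrib_left, Iic_union_Ioc_eq_Iic hst]
    · exact disjoint_left.2 fun x hx hx' => absurd hx.2 (not_le.2 hx'.2.1)
    · exact hU.measurableSet.inter measurableSet_Ioc
  have hle : ∀ s t : ℝ, s ≤ t → volume.real (U ∩ Ioc s t) ≤ t - s := by
    intro s t hst
    calc volume.real (U ∩ Ioc s t) ≤ volume.real (Ioc s t) := 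
          measureReal_mono inter_subset_right (by simp)
      _ = t - s := by simp [hst]
  have key : ∀ s t, s ≤ t → |(s - volume.real (U ∩ Iic s)) - (t - volume.real (U ∩ Iic t))| ≤ |s - t| := by
    intro s t hst
    rw [hadd s t hst]
    have h1 := hle s t hst
    have h2 : 0 ≤ volume.real (U ∩ Ioc s t) := measureReal_nonneg
    rw [abs_of_nonpos (by linarith : s - t ≤ 0), abs_le]
    constructor <;> linarith
  refine ⟨U, fun t => t - volume.real (U ∩ Iic t), hU, hSU, ?_, ?_, ?_⟩
  · intro s t
    rcases le_total s t with hst | hst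
    · exact key s t hst
    · rw [abs_sub_comm, abs_sub_comm s t]
      exact key t s hst
  · intro t
    simp only [sub_sub_cancel_left, abs_neg]
    rw [abs_of_nonneg measureReal_nonneg]
    have : volume (U ∩ Iic t) ≤ ENNReal.ofReal ε := (measure_mono inter_subset_left).trans hvol.le
    exact ENNReal.toReal_le_of_le_ofReal hε.le this
  · intro s t hst hsub
    have : U ∩ Ioc s t = Ioc s t := inter_eq_right.2 (Ioc_subset_Icc_self.trans hsub)
    simp only [hadd s t hst, this]
    rw [Real.volume_real_Ioc_of_le hst]
    ring

lemma null_image {K : Set E2} {ψ : E2 → ℝ} {M : ℝ} (hM : 0 ≤ M)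
    (hψ : ∀ p ∈ K, ∀ y, |ψ y - ψ p| ≤ M * dist y p ^ 3) : volume (ψ '' K) = 0 := by
  have hH : HolderOnWith (Real.toNNReal M) 3 ψ K := by
    intro x hx y hy
    rw [edist_dist, edist_dist, Real.dist_eq]
    have := hψ y hy x
    have h3 : ((3 : ℝ≥0) : ℝ) = ((3 : ℕ) : ℝ) := by norm_num
    rw [h3, ENNReal.rpow_natCast, ← ENNReal.ofReal_pow dist_nonneg]
    change _ ≤ ENNReal.ofReal M * _
    rw [← ENNReal.ofReal_mul hM]
    exact ENNReal.ofReal_le_ofReal this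
  have h1 := hH.dimH_image_le (by norm_num)
  have h2 : dimH K ≤ 2 := by
    refine (dimH_mono (subset_univ K)).trans ?_
    rw [Real.dimH_univ_eq_finrank]
    simp
  have h4 : dimH (ψ '' K) < ((1 : ℝ≥0) : ℝ≥0∞) := by
    refine h1.trans_lt ?_
    refine (ENNReal.div_le_div_right h2 _).trans_lt ?_
    rw [ENNReal.div_lt_iff (by simp) (by simp)]
    norm_num
  have h5 := hausdorffMeasure_of_dimH_lt h4
  rw [NNReal.coe_one, hausdorffMeasure_real] at h5
  exact h5

def eta (K : Set E2) (δ : ℝ) : E2 → ℝ := mol δ ((thickening (2 * δ) K).indicator (fun _ => 1))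

lemma eta_loc (K : Set E2) (δ : ℝ) :
    LocallyIntegrable ((thickening (2 * δ) K).indicator (fun _ => (1 : ℝ)) : E2 → ℝ) :=
  (locallyIntegrable_const 1).indicator isOpen_thickening.measurableSet

lemma eta_smooth (K : Set E2) {δ : ℝ} (hδ : 0 < δ) : ContDiff ℝ (⊤ : ℕ∞) (eta K δ) :=
  mol_smooth hδ (eta_loc K δ)

lemma thick_aux {K : Set E2} {a b c : ℝ} (h : a + b ≤ c) {x y : E2} (hx : x ∈ thickening a K)
    (hy : y ∈ closedBall x b) : y ∈ thickening c K := by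
  rw [mem_thickening_iff] at hx ⊢
  obtain ⟨z, hz, hxz⟩ := hx
  refine ⟨z, hz, ?_⟩
  have := dist_triangle y x z
  rw [mem_closedBall] at hy
  linarith

lemma eta_one {K : Set E2} {δ : ℝ} (hδ : 0 < δ) {x : E2} (hx : x ∈ thickening δ K) :
    eta K δ x = 1 := by
  unfold eta
  rw [mol_congr hδ (g := fun _ => 1), mol_const]
  intro y hy
  rw [indicator_of_mem]
  exact thick_aux (by linarith) hx hy

/-- `C` is an admissible constant for the mollification estimates. -/
def MolC (C : ℝ) : Prop := 0 ≤ C ∧ ∀ n : ℕ, n ≤ 2 → ∀ δ : ℝ, 0 < δ → ∀ g : E2 → ℝ, LocallyIntegrable g →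
    ∀ (x : E2) (A : ℝ), 0 ≤ A → (∀ y ∈ closedBall x δ, |g y| ≤ A) →
      ‖iteratedFDeriv ℝ n (mol δ g) x‖ ≤ C * A * (δ⁻¹) ^ n

lemma eta_bound {C : ℝ} (hC : MolC C) (K : Set E2) {δ : ℝ} (hδ : 0 < δ) (x : E2) {n : ℕ} (hn : n ≤ 2) :
    ‖iteratedFDeriv ℝ n (eta K δ) x‖ ≤ C * (δ⁻¹) ^ n := by
  have := hC.2 n hn δ hδ _ (eta_loc K δ) x 1 zero_le_one (by
    intro y _
    by_cases h : y ∈ thickening (2 * δ) K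
    · simp [h]
    · simp [h])
  simpa [eta] using this

lemma eta_far {C : ℝ} (hC : MolC C) (K : Set E2) {δ : ℝ} (hδ : 0 < δ) {x : E2} 
    (hx : x ∉ thickening (3 * δ) K) {n : ℕ} (hn : n ≤ 2) :
    ‖iteratedFDeriv ℝ n (eta K δ) x‖ = 0 := by
  have := hC.2 n hn δ hδ _ (eta_loc K δ) x 0 le_rfl (by
    intro y hy
    have h : y ∉ thickening (2 * δ) K := by
      intro h
      exact hx (thick_aux (by linarith) h (mem_closedBall_comm.1 hy))
    simp [h])
  apply le_antisymm _ (norm_nonneg _)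
  simpa [eta] using this

lemma T_far {C : ℝ} (hC : MolC C) (K : Set E2) {δ : ℝ} (hδ : 0 < δ) {v : E2 → ℝ}
    (hv : ContDiff ℝ (⊤ : ℕ∞) v) {x : E2} (hx : x ∉ thickening (3 * δ) K) {n : ℕ} (hn : n ≤ 2) :
    ‖iteratedFDeriv ℝ n (fun y => eta K δ y * v y) x‖ = 0 := by
  apply le_antisymm _ (norm_nonneg _)
  refine (norm_iteratedFDeriv_mul_le (eta_smooth K hδ) hv x (by norm_cast; exact le_top)).trans ?_
  apply le_of_eq
  apply Finset.sum_eq_zero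
  intro i hi
  rw [eta_far hC K hδ hx (by simp at hi; omega)]
  simp

lemma T_bound {C : ℝ} (hC : MolC C) (K : Set E2) {δ : ℝ} (hδ : 0 < δ) (hδ1 : δ ≤ 1) {v : E2 → ℝ}
    (hv : ContDiff ℝ (⊤ : ℕ∞) v) {B : ℝ} (hB : 0 ≤ B)
    (hvb : ∀ x ∈ thickening (3 * δ) K, ∀ n : ℕ, n ≤ 2 → 
      ‖iteratedFDeriv ℝ n v x‖ ≤ B * δ ^ 3 * (δ⁻¹) ^ n) 
    (x : E2) {n : ℕ} (hn : n ≤ 2) :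
    ‖iteratedFDeriv ℝ n (fun y => eta K δ y * v y) x‖ ≤ 4 * C * B * δ := by
  have hC0 := hC.1
  by_cases hx : x ∈ thickening (3 * δ) K
  swap
  · rw [T_far hC K hδ hv hx hn]; positivity
  refine (norm_iteratedFDeriv_mul_le (eta_smooth K hδ) hv x (by norm_cast; exact le_top)).trans ?_
  have h1 : ∀ i ∈ Finset.range (n + 1), (n.choose i : ℝ) * ‖iteratedFDeriv ℝ i (eta K δ) x‖ *
      ‖iteratedFDeriv ℝ (n - i) v x‖ ≤ n.choose i * (C * B * δ) := by
    intro i hi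
    have hin : i ≤ n := by simp at hi; omega
    rw [mul_assoc]
    apply mul_le_mul_of_nonneg_left _ (by positivity)
    calc _ ≤ (C * (δ⁻¹) ^ i) * (B * δ ^ 3 * (δ⁻¹) ^ (n - i)) := by
          apply mul_le_mul (eta_bound hC K hδ x (by omega)) (hvb x hx _ (by omega)) (norm_nonneg _)
          positivity
      _ = C * B * (δ ^ 3 * (δ⁻¹) ^ n) := by
          rw [← Nat.add_sub_of_le hin, Nat.add_sub_cancel_left, pow_add]; ring
      _ ≤ C * B * δ := by
          apply mul_le_mul_of_nonneg_left _ (by positivity)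
          interval_cases n
          · simp only [pow_zero, mul_one]
            nlinarith [mul_le_mul hδ1 hδ1 hδ.le zero_le_one]
          · have : δ ^ 3 * δ⁻¹ ^ 1 = δ * δ := by field_simp
            rw [this]; nlinarith
          · have : δ ^ 3 * δ⁻¹ ^ 2 = δ := by field_simp
            rw [this]
  refine (Finset.sum_le_sum h1).trans ?_
  rw [← Finset.sum_mul, ← Nat.cast_sum, Nat.sum_range_choose]
  have : ((2 ^ n : ℕ) : ℝ) ≤ 4 := by interval_cases n <;> norm_num
  have h2 : 0 ≤ C * B * δ := by positivity
  nlinarith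

lemma core {K : Set E2} (hK : IsCompact K) {ψ : E2 → ℝ} (hψc : Continuous ψ) {M : ℝ} (hM : 0 ≤ M)
    (hψ : ∀ p ∈ K, ∀ y, |ψ y - ψ p| ≤ M * dist y p ^ 3) :
    ∃ C, 0 ≤ C ∧ ∀ δ : ℝ, 0 < δ → δ ≤ 1 → ∃ R : E2 → ℝ, ContDiff ℝ (⊤ : ℕ∞) R ∧
      (∀ x, ∀ n : ℕ, n ≤ 2 → ‖iteratedFDeriv ℝ n R x‖ ≤ C * δ) ∧
      (∀ x, x ∉ thickening (3 * δ) K → fderiv ℝ R x = 0) ∧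
      ∃ ρ, 0 < ρ ∧ ∀ x ∈ thickening ρ K, fderiv ℝ (fun y => mol δ ψ y + R y) x = 0 := by
  obtain ⟨C, hC⟩ : ∃ C, MolC C := mol_bound
  have hC0 := hC.1
  set B : ℝ := C + 2 * (C * (152 * M)) with hBdef
  have hB : 0 ≤ B := by positivity
  refine ⟨4 * C * B * 2, by positivity, ?_⟩
  intro δ hδ hδ1
  obtain ⟨U, h, hU, hKU, hlip, hid, hconst⟩ := exists_h (ψ '' K) (null_image hM hψ)
    (pow_pos hδ 3)
  set c : E2 → ℝ := fun x => h (ψ x) with hc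
  have hhc : Continuous h := by
    have : LipschitzWith 1 h := LipschitzWith.of_dist_le_mul (fun s t => by
      simpa [Real.dist_eq] using hlip s t)
    exact this.continuous
  have hcc : Continuous c := hhc.comp hψc
  -- neighbourhood on which `c` is locally constant
  have hVopen : IsOpen (ψ ⁻¹' U) := hU.preimage hψc
  obtain ⟨τ, hτ, hτV⟩ := hK.exists_thickening_subset_open hVopen (image_subset_iff.1 hKU)
  have hcconst : ∀ x r, closedBall x r ⊆ ψ ⁻¹' U → ∀ y ∈ closedBall x r, c y = c x := by
    intro x r hsub y hy
    have hr : 0 ≤ r := dist_nonneg.trans hy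
    have hconn : (ψ '' closedBall x r).OrdConnected :=
      ((convex_closedBall x r).isPreconnected.image ψ hψc.continuousOn).ordConnected
    have hsubU : ψ '' closedBall x r ⊆ U := image_subset_iff.2 hsub
    have hx' : ψ x ∈ ψ '' closedBall x r := mem_image_of_mem _ (mem_closedBall_self hr)
    have hy' : ψ y ∈ ψ '' closedBall x r := mem_image_of_mem _ hy
    rcases le_total (ψ x) (ψ y) with hle | hle
    · exact (hconst _ _ hle ((hconn.out hx' hy').trans hsubU)).symm
    · exact hconst _ _ hle ((hconn.out hy' hx').trans hsubU)
  -- oscillation estimate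
  have hosc : ∀ r, 0 < r → ∀ x ∈ thickening (3 * r) K, ∀ y ∈ closedBall x (2 * r),
      |c y - c x| ≤ 152 * M * r ^ 3 := by
    intro r hr x hx y hy
    rw [mem_thickening_iff] at hx
    obtain ⟨p, hp, hxp⟩ := hx
    have h1 := hψ p hp y
    have h2 := hψ p hp x
    have h3 : dist y p ≤ 5 * r := by
      have := dist_triangle y x p
      rw [mem_closedBall] at hy
      linarith
    have h4 : dist y p ^ 3 ≤ (5 * r) ^ 3 := pow_le_pow_left₀ dist_nonneg h3 3
    have h5 : dist x p ^ 3 ≤ (3 * r) ^ 3 := pow_le_pow_left₀ dist_nonneg hxp.le 3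
    have h6 : |ψ y - ψ x| ≤ |ψ y - ψ p| + |ψ x - ψ p| := by
      rw [abs_sub_comm (ψ x) (ψ p)]
      exact abs_sub_le _ _ _
    have h7 := hlip (ψ y) (ψ x)
    have h8 := mul_le_mul_of_nonneg_left h4 hM
    have h9 := mul_le_mul_of_nonneg_left h5 hM
    change |h (ψ y) - h (ψ x)| ≤ _
    nlinarith
  set d : ℕ → ℝ := fun n => δ * (1 / 2) ^ n with hd
  have hdpos : ∀ n, 0 < d n := fun n => by positivity
  have hdle : ∀ n, d n ≤ δ := fun n => by
    have : (1 / 2 : ℝ) ^ n ≤ 1 := pow_le_one₀ (by norm_num) (by norm_num)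
    simp only [hd]; nlinarith
  have hdsucc : ∀ n, d n = 2 * d (n + 1) := fun n => by simp only [hd, pow_succ]; ring
  have hcloc : ∀ a : ℝ, LocallyIntegrable (fun y => c y - a) := fun a =>
    (hcc.sub continuous_const).locallyIntegrable
  have hmolc : ∀ (r a : ℝ), mol r c = fun x => mol r (fun y => c y - a) x + a := by
    intro r a
    funext x
    rw [mol_sub hcc continuous_const, mol_const]; ring
  set v : ℕ → E2 → ℝ := fun n => Nat.casesOn n (mol δ (fun y => c y - ψ y))
    (fun n => fun x => mol (d (n + 1)) c x - mol (d n) c x) with hv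
  have hvsm : ∀ n, ContDiff ℝ (⊤ : ℕ∞) (v n) := by
    intro n
    cases n with
    | zero => exact mol_smooth hδ (hcc.sub hψc).locallyIntegrable
    | succ n => exact (mol_smooth (hdpos _) hcc.locallyIntegrable).sub 
                  (mol_smooth (hdpos _) hcc.locallyIntegrable)
  have hvb : ∀ n, ∀ x ∈ thickening (3 * d n) K, ∀ j : ℕ, j ≤ 2 →
      ‖iteratedFDeriv ℝ j (v n) x‖ ≤ B * (d n) ^ 3 * ((d n)⁻¹) ^ j := by
    intro n x hx j hj
    cases n with
    | zero =>
      have hd0 : d 0 = δ := by simp [hd]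
      rw [hd0]
      have := hC.2 j hj δ hδ _ (hcc.sub hψc).locallyIntegrable x (δ ^ 3) (by positivity)
        (fun y _ => hid (ψ y))
      refine this.trans ?_
      have hCB : C ≤ B := by 
        have : 0 ≤ 2 * (C * (152 * M)) := by positivity
        linarith
      gcongr
    | succ n =>
      set r := d (n + 1) with hr
      have hrp : 0 < r := hdpos _
      have hvn : v (n + 1) = (mol r (fun y => c y - c x)) - (mol (2 * r) (fun y => c y - c x)) := by
        funext z
        change mol (d (n + 1)) c z - mol (d n) c z = _
        rw [hmolc (d (n + 1)) (c x), hmolc (d n) (c x), hdsucc n]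
        simp only [Pi.sub_apply]
        ring
      have s1 := mol_smooth hrp (hcloc (c x))
      have s2 := mol_smooth (by positivity : 0 < 2 * r) (hcloc (c x))
      rw [hvn, iteratedFDeriv_sub_apply (s1.of_le (by norm_cast; exact le_top)).contDiffAt
        (s2.of_le (by norm_cast; exact le_top)).contDiffAt]
      have b1 := hC.2 j hj r hrp _ (hcloc (c x)) x (152 * M * r ^ 3) (by positivity)
        (fun y hy => hosc r hrp x hx y (closedBall_subset_closedBall (by linarith) hy))
      have b2 := hC.2 j hj (2 * r) (by positivity) _ (hcloc (c x)) x (152 * M * r ^ 3) (by positivity)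
        (fun y hy => hosc r hrp x hx y hy)
      have b3 : ((2 * r)⁻¹) ^ j ≤ (r⁻¹) ^ j := by
        apply pow_le_pow_left₀ (by positivity)
        exact inv_anti₀ hrp (by linarith)
      have b4 : C * (152 * M * r ^ 3) * ((2 * r)⁻¹) ^ j ≤ C * (152 * M * r ^ 3) * (r⁻¹) ^ j := by
        gcongr
      refine (norm_sub_le _ _).trans ?_
      have b5 : 0 ≤ C * r ^ 3 * (r⁻¹) ^ j := by positivity
      have b6 : B * r ^ 3 * (r⁻¹) ^ j = C * r ^ 3 * (r⁻¹) ^ j + 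
        2 * (C * (152 * M * r ^ 3) * (r⁻¹) ^ j) := by rw [hBdef]; ring
      linarith
  obtain ⟨N, hN⟩ : ∃ N, d N < τ / 2 := by
    have h0 : Tendsto d atTop (𝓝 (δ * 0)) :=
      (tendsto_pow_atTop_nhds_zero_of_lt_one (by norm_num) (by norm_num)).const_mul δ
    rw [mul_zero] at h0
    exact (h0.eventually (gt_mem_nhds (by positivity))).exists
  have hTsm : ∀ n, ContDiff ℝ (⊤ : ℕ∞) (fun y => eta K (d n) y * v n y) := fun n =>
    (eta_smooth K (hdpos n)).mul (hvsm n)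
  set R : E2 → ℝ := fun y => ∑ n ∈ Finset.range (N + 1), eta K (d n) y * v n y with hR
  have hRder : ∀ x (j : ℕ), iteratedFDeriv ℝ j R x = ∑ n ∈ Finset.range (N + 1),
      iteratedFDeriv ℝ j (fun y => eta K (d n) y * v n y) x := by
    intro x j
    exact iteratedFDeriv_fun_sum_apply 
      (fun n _ => ((hTsm n).of_le (by norm_cast; exact le_top)).contDiffAt)
  have htel : ∀ N x, ∑ n ∈ Finset.range (N + 1), v n x = mol (d N) c x - mol δ ψ x := by
    intro N x
    induction N with
    | zero =>
      have hd0 : d 0 = δ := by simp [hd]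
      rw [hd0]
      simp only [zero_add, Finset.sum_range_one]
      exact mol_sub hcc hψc δ x
    | succ N ih =>
      rw [Finset.sum_range_succ, ih]
      change _ + (mol (d (N + 1)) c x - mol (d N) c x) = _
      ring
  refine ⟨R, ContDiff.sum fun n _ => hTsm n, ?_, ?_, d N, hdpos N, ?_⟩
  · intro x j hj
    rw [hRder]
    refine (norm_sum_le _ _).trans ?_
    refine (Finset.sum_le_sum (fun n _ => T_bound hC K (hdpos n) ((hdle n).trans hδ1) (hvsm n)
      hB (hvb n) x hj)).trans ?_
    rw [← Finset.mul_sum]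
    simp only [hd]
    rw [← Finset.mul_sum]
    have := sum_geometric_two_le (N + 1)
    have h4 : 0 ≤ 4 * C * B * δ := by positivity
    nlinarith
  · intro x hx
    rw [← norm_eq_zero, ← norm_iteratedFDeriv_one, hRder, norm_eq_zero]
    apply Finset.sum_eq_zero
    intro n _
    rw [← norm_eq_zero]
    apply T_far hC K (hdpos n) (hvsm n) _ (by norm_num)
    intro hx'
    exact hx (thickening_mono (by linarith [hdle n]) K hx')
  · intro x hx
    have hdN : ∀ n ≤ N, d N ≤ d n := by
      intro n hn
      simp only [hd]
      exact mul_le_mul_of_nonneg_left (pow_le_pow_of_le_one (by norm_num) (by norm_num) hn) hδ.le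
    have heq : (fun y => mol δ ψ y + R y) =ᶠ[𝓝 x] mol (d N) c := by
      filter_upwards [isOpen_thickening.mem_nhds hx] with y hy
      have : R y = ∑ n ∈ Finset.range (N + 1), v n y := by
        apply Finset.sum_congr rfl
        intro n hn
        rw [eta_one (hdpos n), one_mul]
        exact thickening_mono (hdN n (by simp at hn; omega)) K hy
      rw [this, htel]; ring
    rw [heq.fderiv_eq, ← norm_eq_zero, ← norm_iteratedFDeriv_one, hmolc (d N) (c x)]
    have := hC.2 1 (by norm_num) (d N) (hdpos N) _ (hcloc (c x)) x 0 le_rfl (by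
      intro y hy
      rw [hcconst x (d N) _ y hy]
      · simp
      · intro z hz
        exact hτV (thick_aux (by linarith) hx hz))
    rw [norm_iteratedFDeriv_one] at this ⊢
    rw [fderiv_add_const]
    apply le_antisymm _ (norm_nonneg _)
    simpa using this

def Jmap : E2 →L[ℝ] (E2 →L[ℝ] ℝ) := LinearMap.toContinuousLinearMap
  { toFun := fun v => v 0 • (EuclideanSpace.proj 1 : E2 →L[ℝ] ℝ) - v 1 • (EuclideanSpace.proj 0 : E2 →L[ℝ] ℝ)
    map_add' := by intro v w; ext x; simp; ring
    map_smul' := by intro a v; ext x; simp; ring }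

lemma Jmap_apply (v x : E2) : Jmap v x = v 0 * x 1 - v 1 * x 0 := by
  simp [Jmap]

def Lmap : (E2 →L[ℝ] ℝ) →L[ℝ] E2 := LinearMap.toContinuousLinearMap
  { toFun := fun α => !₂[α (EuclideanSpace.single 1 1), - α (EuclideanSpace.single 0 1)]
    map_add' := by intro v w; ext i; fin_cases i <;> simp; ring
    map_smul' := by intro a v; ext i; fin_cases i <;> simp }

lemma Lmap_zero (α : E2 →L[ℝ] ℝ) : Lmap α 0 = α (EuclideanSpace.single 1 1) := by simp [Lmap]
lemma Lmap_one (α : E2 →L[ℝ] ℝ) : Lmap α 1 = - α (EuclideanSpace.single 0 1) := by simp [Lmap]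

lemma LJ (v : E2) : Lmap (Jmap v) = v := by
  ext i
  fin_cases i
  · simp [Lmap_zero, Jmap_apply]
  · simp [Lmap_one, Jmap_apply]

lemma decomp (x : E2) : x = x 0 • EuclideanSpace.single (0 : Fin 2) (1 : ℝ) + x 1 • EuclideanSpace.single (1 : Fin 2) (1 : ℝ) := by
  ext i
  fin_cases i <;> simp

lemma exists_potential {u : E2 → E2} (hu : Differentiable ℝ u) (hdiv : divFree u) :
    ∃ ψ : E2 → ℝ, ∀ x, HasFDerivAt ψ (Jmap (u x)) x := by
  have hder : ∀ a, HasFDerivAt (fun x => Jmap (u x)) (Jmap ∘L fderiv ℝ u a) a := fun a =>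
    Jmap.hasFDerivAt.comp a (hu a).hasFDerivAt
  obtain ⟨f, hf⟩ := (convex_univ (𝕜 := ℝ) (E := E2)).exists_forall_hasFDerivAt_of_fderiv_symmetric
    (ω := fun x => Jmap (u x)) isOpen_univ (fun a _ => (hder a).differentiableAt.differentiableWithinAt) (by
      intro a _ x y
      rw [(hder a).fderiv]
      have hd := hdiv a
      rw [Fin.sum_univ_two] at hd
      simp only [ContinuousLinearMap.comp_apply, Jmap_apply]
      have hx : fderiv ℝ u a x = x 0 • fderiv ℝ u a (EuclideanSpace.single 0 1) + 
        x 1 • fderiv ℝ u a (EuclideanSpace.single 1 1) := by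
        conv_lhs => rw [decomp x]
        simp
      have hy : fderiv ℝ u a y = y 0 • fderiv ℝ u a (EuclideanSpace.single 0 1) + 
        y 1 • fderiv ℝ u a (EuclideanSpace.single 1 1) := by
        conv_lhs => rw [decomp y]
        simp
      rw [hx, hy]
      simp only [PiLp.add_apply, PiLp.smul_apply, smul_eq_mul]
      linear_combination (x 0 * y 1 - x 1 * y 0) * hd)
  exact ⟨f, fun x => hf x (mem_univ x)⟩

lemma divFree_curl {f : E2 → ℝ} (hf : ContDiff ℝ (⊤ : ℕ∞) f) : 
    divFree (fun x => Lmap (fderiv ℝ f x)) := by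
  intro x
  have hf' : ContDiff ℝ (⊤ : ℕ∞) (fderiv ℝ f) := hf.fderiv_right (by simp)
  have h1 : HasFDerivAt (fun x => Lmap (fderiv ℝ f x)) (Lmap ∘L fderiv ℝ (fderiv ℝ f) x) x :=
    Lmap.hasFDerivAt.comp x ((hf'.differentiable (by simp)) x).hasFDerivAt
  rw [h1.fderiv, Fin.sum_univ_two]
  simp only [ContinuousLinearMap.comp_apply, Lmap_zero, Lmap_one]
  have := (hf.contDiffAt (x := x)).isSymmSndFDerivAt (by simp; norm_cast)
  rw [this.eq]
  ring

lemma bdd_aux {F : Type} [NormedAddCommGroup F] {f : E2 → F} (hf : Continuous f)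
    (hs : HasCompactSupport f) : ∃ M : ℝ, ∀ x, ‖f x‖ ≤ M :=
  hf.bounded_above_of_compact_support hs

lemma lip_aux {F : Type} [NormedAddCommGroup F] [NormedSpace ℝ F] {f : E2 → F} (hf : ContDiff ℝ 1 f)
    (hs : HasCompactSupport f) : ∃ M : ℝ, ∀ x y, ‖f y - f x‖ ≤ M * ‖y - x‖ := by
  obtain ⟨M, hM⟩ := bdd_aux (hf.continuous_fderiv (by simp)) (hs.fderiv ℝ)
  exact ⟨M, fun x y => convex_univ.norm_image_sub_le_of_norm_fderiv_le (𝕜 := ℝ)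
      (fun z _ => hf.differentiable (by simp) z) (fun z _ => hM z) (mem_univ x) (mem_univ y)⟩

set_option maxHeartbeats 1000000 in
theorem norm_sub_of_zero {F : Type*} [NormedAddCommGroup F] (a b : F) (hb : b = 0) :
    ‖a - b‖ = ‖a‖ := by rw [hb, sub_zero]

lemma approx (K : Set E2) (hK : IsCompact K)
    (u : E2 → E2) (hu : ContDiff ℝ 2 u) (hsupp : HasCompactSupport u)
    (hdiv : divFree u)
    (hu0 : ∀ x ∈ K, u x = 0) (hdu0 : ∀ x ∈ K, fderiv ℝ u x = 0) :
    ∃ C : ℝ, 0 ≤ C ∧ ∀ δ : ℝ, 0 < δ → δ ≤ 1 → ∃ w : E2 → E2,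
      (ContDiff ℝ (⊤ : ℕ∞) w ∧ HasCompactSupport w ∧ divFree w ∧ tsupport w ⊆ Kᶜ) ∧
      ∀ x, ‖w x - u x‖ ≤ C * δ ∧ ‖fderiv ℝ w x - fderiv ℝ u x‖ ≤ C * δ := by
  have hud : Differentiable ℝ u := hu.differentiable (by simp)
  obtain ⟨ψ, hψ⟩ := exists_potential hud hdiv
  set f : E2 → (E2 →L[ℝ] ℝ) := fun x => Jmap (u x) with hf
  have hfψ : fderiv ℝ ψ = f := funext fun x => (hψ x).fderiv
  have hf2 : ContDiff ℝ 2 f := Jmap.contDiff.comp hu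
  have hfsupp : HasCompactSupport f := hsupp.comp_left (g := Jmap) (map_zero _)
  have hDf : ∀ x, fderiv ℝ f x = Jmap ∘L fderiv ℝ u x := fun x =>
    (Jmap.hasFDerivAt.comp x (hud x).hasFDerivAt).fderiv
  have hDf1 : ContDiff ℝ 1 (fderiv ℝ f) := hf2.fderiv_right (by norm_num)
  have hψ1 : ContDiff ℝ 1 ψ := by
    rw [contDiff_one_iff_fderiv]
    refine ⟨fun x => (hψ x).differentiableAt, ?_⟩
    rw [hfψ]; exact hf2.continuous
  obtain ⟨M0, hM0⟩ := bdd_aux hf2.continuous hfsupp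
  obtain ⟨M1, hM1⟩ := bdd_aux hDf1.continuous (hfsupp.fderiv ℝ)
  obtain ⟨M2, hM2⟩ := lip_aux (hf2.of_le (by norm_num)) hfsupp
  obtain ⟨M3, hM3⟩ := lip_aux hDf1 (hfsupp.fderiv ℝ)
  set M := max 0 (max M2 M3) with hM
  have hM0' : 0 ≤ M := le_max_left _ _
  have hlip1 : ∀ x y, ‖f y - f x‖ ≤ M * ‖y - x‖ := fun x y => (hM2 x y).trans
    (mul_le_mul_of_nonneg_right ((le_max_left _ _).trans (le_max_right _ _)) (norm_nonneg _))
  have hlip2 : ∀ x y, ‖fderiv ℝ f y - fderiv ℝ f x‖ ≤ M * ‖y - x‖ := fun x y => (hM3 x y).trans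
    (mul_le_mul_of_nonneg_right ((le_max_right _ _).trans (le_max_right _ _)) (norm_nonneg _))
  have hK2 : ∀ p ∈ K, ∀ y, ‖fderiv ℝ f y‖ ≤ M * ‖y - p‖ := by
    intro p hp y
    have := hlip2 p y
    have hz : fderiv ℝ f p = 0 := by
      rw [hDf p, hdu0 p hp]; exact ContinuousLinearMap.comp_zero _
    have h2 := norm_sub_of_zero (F := E2 →L[ℝ] E2 →L[ℝ] ℝ) (fderiv ℝ f y) (fderiv ℝ f p) hz
    exact h2.symm.le.trans this
  have hK1 : ∀ p ∈ K, ∀ y, ‖f y‖ ≤ M * ‖y - p‖ ^ 2 := by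
    intro p hp y
    have := (convex_closedBall p ‖y - p‖).norm_image_sub_le_of_norm_fderiv_le (𝕜 := ℝ)
      (f := f) (C := M * ‖y - p‖) (x := p) (y := y)
      (fun z _ => hf2.differentiable (by simp) z) (fun z hz => by
        refine (hK2 p hp z).trans ?_
        rw [mem_closedBall, dist_eq_norm] at hz
        gcongr) (mem_closedBall_self (norm_nonneg _)) (by rw [mem_closedBall, dist_eq_norm])
    have hfp : f p = 0 := by simp [hf, hu0 p hp]
    rw [hfp, sub_zero] at this
    linarith
  have hK0 : ∀ p ∈ K, ∀ y, |ψ y - ψ p| ≤ M * dist y p ^ 3 := by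
    intro p hp y
    have := (convex_closedBall p ‖y - p‖).norm_image_sub_le_of_norm_fderiv_le (𝕜 := ℝ)
      (f := ψ) (C := M * ‖y - p‖ ^ 2) (x := p) (y := y)
      (fun z _ => (hψ z).differentiableAt) (fun z hz => by
        rw [hfψ]
        refine (hK1 p hp z).trans ?_
        rw [mem_closedBall, dist_eq_norm] at hz
        gcongr) (mem_closedBall_self (norm_nonneg _)) (by rw [mem_closedBall, dist_eq_norm])
    rw [Real.norm_eq_abs] at this
    rw [dist_eq_norm]
    linarith
  obtain ⟨C, hC, hcore⟩ := core hK hψ1.continuous hM0' hK0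
  refine ⟨‖Lmap‖ * (M + C), by positivity, ?_⟩
  intro δ hδ hδ1
  obtain ⟨R, hR, hRb, hRfar, ρ, hρ, hRK⟩ := hcore δ hδ hδ1
  set g : E2 → ℝ := fun y => mol δ ψ y + R y with hg
  have hgs : ContDiff ℝ (⊤ : ℕ∞) g := (mol_smooth hδ hψ1.continuous.locallyIntegrable).add hR
  have hRd : Differentiable ℝ R := hR.differentiable (by simp)
  have hR' : ContDiff ℝ (⊤ : ℕ∞) (fderiv ℝ R) := hR.fderiv_right (by simp)
  have hg' : ContDiff ℝ (⊤ : ℕ∞) (fderiv ℝ g) := hgs.fderiv_right (by simp)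
  have hDg : fderiv ℝ g = fun x => mol δ f x + fderiv ℝ R x := by
    funext x
    have h1 := mol_deriv δ hψ1 (M := M0) (fun x => by rw [hfψ]; exact hM0 x) x
    rw [hfψ] at h1
    exact (h1.add (hRd x).hasFDerivAt).fderiv
  have hD2g : ∀ x, fderiv ℝ (fderiv ℝ g) x = mol δ (fderiv ℝ f) x + fderiv ℝ (fderiv ℝ R) x := by
    intro x
    rw [hDg]
    have h1 := mol_deriv δ (hf2.of_le (by norm_num)) hM1 x
    exact (h1.add ((hR'.differentiable (by simp)) x).hasFDerivAt).fderiv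
  have hDw : ∀ x, fderiv ℝ (fun x => Lmap (fderiv ℝ g x)) x = Lmap ∘L fderiv ℝ (fderiv ℝ g) x := 
    fun x => (Lmap.hasFDerivAt.comp x ((hg'.differentiable (by simp)) x).hasFDerivAt).fderiv
  have hR1 : ∀ x, ‖fderiv ℝ R x‖ ≤ C * δ := fun x => by
    rw [← norm_iteratedFDeriv_one]; exact hRb x 1 (by norm_num)
  have hR2 : ∀ x, ‖fderiv ℝ (fderiv ℝ R) x‖ ≤ C * δ := fun x => by
    rw [← norm_iteratedFDeriv_one, norm_iteratedFDeriv_fderiv]; exact hRb x 2 (by norm_num)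
  refine ⟨fun x => Lmap (fderiv ℝ g x), ⟨Lmap.contDiff.comp hg', ?_, divFree_curl hgs, ?_⟩, ?_⟩
  · have hc1 : IsCompact (cthickening (3 * δ) K ∪ cthickening δ (tsupport u)) :=
      hK.cthickening.union (IsCompact.cthickening hsupp)
    refine HasCompactSupport.intro hc1 fun x hx => ?_
    have h1 : x ∉ thickening (3 * δ) K := fun h => hx (Or.inl (thickening_subset_cthickening _ _ h))
    have h2 : mol δ f x = 0 := by
      rw [mol_congr hδ (g := fun _ => 0)]
      · simp [mol]
      · intro y hy
        have : y ∉ tsupport u := fun h => hx (Or.inr 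
          (mem_cthickening_of_dist_le x y δ _ h (mem_closedBall_comm.1 hy)))
        simp only [hf]
        rw [image_eq_zero_of_notMem_tsupport this, map_zero]
    simp only [hDg]
    rw [h2, hRfar x h1, add_zero, map_zero]
  · have hdis : Disjoint (thickening ρ K) (tsupport (fun x => Lmap (fderiv ℝ g x))) := by
      apply Disjoint.closure_right _ isOpen_thickening
      rw [disjoint_left]
      intro x hx hx'
      apply hx'
      simp only [hRK x hx, map_zero]
    intro x hx hxK
    exact disjoint_left.1 hdis (self_subset_thickening hρ K hxK) hx
  · intro x
    have key : ∀ y ∈ closedBall x δ, M * ‖y - x‖ ≤ M * δ := fun y hy => by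
      rw [mem_closedBall, dist_eq_norm] at hy
      gcongr
    have e1 : ‖mol δ f x - f x‖ ≤ M * δ := mol_close hδ hf2.continuous 
      (fun y hy => (hlip1 x y).trans (key y hy))
    have e2 : ‖mol δ (fderiv ℝ f) x - fderiv ℝ f x‖ ≤ M * δ := mol_close hδ hDf1.continuous 
      (fun y hy => (hlip2 x y).trans (key y hy))
    constructor
    · have : Lmap (fderiv ℝ g x) - u x = Lmap ((mol δ f x - f x) + fderiv ℝ R x) := by
        conv_lhs => rw [← LJ (u x), ← map_sub]
        rw [hDg]
        congr 1
        simp only [hf]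
        abel
      simp only [this]
      refine (Lmap.le_opNorm _).trans ?_
      rw [mul_assoc]
      apply mul_le_mul_of_nonneg_left _ (norm_nonneg _)
      refine (norm_add_le _ _).trans ?_
      linarith [hR1 x]
    · have hDu : fderiv ℝ u x = Lmap ∘L fderiv ℝ f x := by
        ext1 v
        rw [hDf]
        simp only [ContinuousLinearMap.comp_apply, LJ]
      have : fderiv ℝ (fun x => Lmap (fderiv ℝ g x)) x - fderiv ℝ u x = 
          Lmap ∘L ((mol δ (fderiv ℝ f) x - fderiv ℝ f x) + fderiv ℝ (fderiv ℝ R) x) := by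
        rw [hDw, hDu, hD2g, ← ContinuousLinearMap.comp_sub]
        congr 1
        abel
      rw [this]
      refine (ContinuousLinearMap.opNorm_comp_le _ _).trans ?_
      rw [mul_assoc]
      apply mul_le_mul_of_nonneg_left _ (norm_nonneg _)
      refine (norm_add_le _ _).trans ?_
      linarith [hR2 x]

/-- **Divergence-free approximation in `C¹`** (Theorem 1.5). Let `K ⊂ ℝ²` be compact and
`u ∈ C_c²(ℝ²;ℝ²)` divergence-free with `u = 0` and `∇u = 0` on `K`. Then there is a
sequence of smooth divergence-free vector fields supported away from `K` converging to `u`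
in the `C¹` norm. -/
theorem divfree_approximation_C1
    (K : Set E2) (hK : IsCompact K)
    (u : E2 → E2) (hu : ContDiff ℝ 2 u) (hsupp : HasCompactSupport u)
    (hdiv : divFree u)
    (hu0 : ∀ x ∈ K, u x = 0) (hdu0 : ∀ x ∈ K, fderiv ℝ u x = 0) :
    ∃ uk : ℕ → E2 → E2,
      (∀ k, ContDiff ℝ (⊤ : ℕ∞) (uk k) ∧ HasCompactSupport (uk k) ∧ divFree (uk k) ∧
        tsupport (uk k) ⊆ Kᶜ) ∧
      TendstoUniformly (fun k => uk k) u atTop ∧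
      TendstoUniformly (fun k => fderiv ℝ (uk k)) (fderiv ℝ u) atTop := by
  obtain ⟨C, hC, h⟩ := approx K hK u hu hsupp hdiv hu0 hdu0
  have hpos : ∀ k : ℕ, (0 : ℝ) < 1 / ((k : ℝ) + 1) := fun k => by positivity
  have hle : ∀ k : ℕ, 1 / ((k : ℝ) + 1) ≤ 1 := fun k => by
    rw [div_le_one (by positivity)]
    have : (0 : ℝ) ≤ k := by positivity
    linarith
  choose w hw hb using fun k : ℕ => h (1 / ((k : ℝ) + 1)) (hpos k) (hle k)
  have hlim : Tendsto (fun k : ℕ => C * (1 / ((k : ℝ) + 1))) atTop (𝓝 0) := by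
    simpa using (tendsto_one_div_add_atTop_nhds_zero_nat (𝕜 := ℝ)).const_mul C
  refine ⟨w, hw, ?_, ?_⟩
  · rw [Metric.tendstoUniformly_iff]
    intro ε hε
    filter_upwards [hlim.eventually (gt_mem_nhds hε)] with k hk x
    rw [dist_comm, dist_eq_norm]
    exact ((hb k x).1).trans_lt hk
  · rw [Metric.tendstoUniformly_iff]
    intro ε hε
    filter_upwards [hlim.eventually (gt_mem_nhds hε)] with k hk x
    rw [dist_comm, dist_eq_norm]
    exact ((hb k x).2).trans_lt hk

end DFA
end
end

section
/- Let m ∈ ℕ, 0 ≤ γ ≤ 1, let K ⊂ ℝⁿ be any compact set, and let F ∈ C_c^{m,γ}(ℝⁿ). Suppose that D^j F(x) = 0 for every x ∈ K and every multi-index j with 0 ≤ |j| ≤ m, and, if γ > 0, suppose in addition that lim_{ε→0⁺} |∇^m F|_{C^{0,γ}(K_ε)} = 0. Then there exists a sequence of smooth cutoff functions η_k ∈ C_c^∞(ℝⁿ), each equal to 1 on a neighborhood of K, such that the functions F_k := F(1−η_k) are supported in ℝⁿ ∖ K and F_k → F in the C^{m,γ} norm. -/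
open MeasureTheory Filter Topology Metric Set
open scoped ENNReal NNReal Classical

noncomputable section

namespace DFA

/-- The `γ`-Hölder seminorm of `f` on the set `E`, valued in `ℝ≥0∞`. -/
def eHolder {X Y : Type*} [PseudoEMetricSpace X] [PseudoEMetricSpace Y]
    (γ : ℝ) (f : X → Y) (E : Set X) : ℝ≥0∞ :=
  ⨆ (x : X) (_ : x ∈ E) (y : X) (_ : y ∈ E) (_ : x ≠ y), edist (f x) (f y) / edist x y ^ γ

open scoped Convolution in
theorem conv_bound_s9 {n : ℕ} (j : ℕ) : ∀ {V : Type} [NormedAddCommGroup V] [NormedSpace ℝ V]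
    (g : Euc n → V) (_ : ContDiff ℝ (⊤ : ℕ∞) g) (_ : HasCompactSupport g),
    ∃ C : ℝ, ∀ A : Set (Euc n), MeasurableSet A → ∀ x,
      ‖iteratedFDeriv ℝ j (A.indicator (fun _ => (1:ℝ)) ⋆[ContinuousLinearMap.lsmul ℝ ℝ, volume] g) x‖ ≤ C := by
  induction j with
  | zero =>
    intro V _ _ g hg hc
    refine ⟨∫ t, ‖g t‖, fun A hA x => ?_⟩
    rw [norm_iteratedFDeriv_zero]
    have hint : Integrable g := hg.continuous.integrable_of_hasCompactSupport hc
    calc _ ≤ ∫ t, ‖g (x - t)‖ := by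
          refine norm_integral_le_of_norm_le (hint.comp_sub_left x).norm ?_
          refine Eventually.of_forall fun t => ?_
          by_cases h : t ∈ A <;> simp [h]
      _ = _ := integral_sub_left_eq_self (fun t => ‖g t‖) volume x
  | succ j ih =>
    intro V _ _ g hg hc
    obtain ⟨C, hC⟩ := ih (fderiv ℝ g) (hg.fderiv_right (by simp)) (hc.fderiv ℝ)
    refine ⟨C, fun A hA x => ?_⟩
    rw [← norm_iteratedFDeriv_fderiv]
    have hloc : LocallyIntegrable (A.indicator (fun _ => (1:ℝ))) (volume : Measure (Euc n)) :=
      (locallyIntegrable_const 1).indicator hA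
    have : fderiv ℝ (A.indicator (fun _ => (1:ℝ)) ⋆[ContinuousLinearMap.lsmul ℝ ℝ, volume] g)
      = (A.indicator (fun _ => (1:ℝ)) ⋆[ContinuousLinearMap.lsmul ℝ ℝ, volume] (fderiv ℝ g)) := by
      funext y
      rw [(hc.hasFDerivAt_convolution_right (ContinuousLinearMap.lsmul ℝ ℝ) hloc
        (hg.of_le (by exact_mod_cast le_top)) y).fderiv]
      congr 1
    rw [this]
    exact hC A hA x

open scoped Convolution in
/-- unit-scale cutoffs -/
theorem cutoff_unit (n N : ℕ) : ∃ M : ℝ, 0 ≤ M ∧ ∀ K : Set (Euc n), ∃ ζ : Euc n → ℝ,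
    ContDiff ℝ (⊤ : ℕ∞) ζ ∧ (∀ x ∈ thickening 1 K, ζ x = 1) ∧ (∀ x ∉ thickening 3 K, ζ x = 0) ∧
    ∀ j ≤ N, ∀ x, ‖iteratedFDeriv ℝ j ζ x‖ ≤ M := by
  let φ : ContDiffBump (0 : Euc n) := ⟨1/2, 1, by norm_num, by norm_num⟩
  choose C hC using fun j => conv_bound_s9 (n := n) j (φ.normed volume) φ.contDiff_normed
    φ.hasCompactSupport_normed
  refine ⟨∑ j ∈ Finset.range (N+1), |C j|, by positivity, fun K => ?_⟩
  let A := thickening 2 K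
  have hA : MeasurableSet A := isOpen_thickening.measurableSet
  have hloc : LocallyIntegrable (A.indicator (fun _ => (1:ℝ))) (volume : Measure (Euc n)) :=
      (locallyIntegrable_const 1).indicator hA
  have hval : ∀ x, (∀ y ∈ ball x 1, A.indicator (fun _ => (1:ℝ)) y = A.indicator (fun _ => (1:ℝ)) x) →
    (A.indicator (fun _ => (1:ℝ)) ⋆[ContinuousLinearMap.lsmul ℝ ℝ, volume] (φ.normed volume)) x
      = A.indicator (fun _ => (1:ℝ)) x := by
    intro x hx
    rw [← convolution_flip]
    have : (ContinuousLinearMap.lsmul ℝ ℝ).flip = (ContinuousLinearMap.lsmul ℝ ℝ : ℝ →L[ℝ] ℝ →L[ℝ] ℝ) := by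
      ext; simp
    rw [this]
    exact φ.normed_convolution_eq_right hx
  refine ⟨A.indicator (fun _ => (1:ℝ)) ⋆[ContinuousLinearMap.lsmul ℝ ℝ, volume] (φ.normed volume),
    ?_, ?_, ?_, ?_⟩
  · exact φ.hasCompactSupport_normed.contDiff_convolution_right _ hloc φ.contDiff_normed
  · intro x hx
    have hball : ∀ y ∈ ball x 1, y ∈ A := by
      intro y hy
      rw [mem_thickening_iff] at hx
      obtain ⟨z, hz, hxz⟩ := hx
      refine mem_thickening_iff.2 ⟨z, hz, ?_⟩
      rw [mem_ball] at hy
      linarith [dist_triangle y x z]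
    have hxA := hball x (mem_ball_self one_pos)
    rw [hval x]
    · simp [hxA]
    · intro y hy
      simp [hball y hy, hxA]
  · intro x hx
    have hball : ∀ y ∈ ball x 1, y ∉ A := by
      intro y hy hyA
      apply hx
      obtain ⟨z, hz, hxz⟩ := mem_thickening_iff.1 hyA
      refine mem_thickening_iff.2 ⟨z, hz, ?_⟩
      rw [mem_ball, dist_comm] at hy
      linarith [dist_triangle x y z]
    have hxA := hball x (mem_ball_self one_pos)
    rw [hval x]
    · simp [hxA]
    · intro y hy
      simp [hball y hy, hxA]
  · intro j hj x
    refine (hC j A hA x).trans ((le_abs_self _).trans ?_)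
    exact Finset.single_le_sum (f := fun j => |C j|) (fun _ _ => abs_nonneg _)
      (Finset.mem_range.2 (by omega))

/-- scaled cutoffs -/
theorem cutoff_scaled (n N : ℕ) : ∃ M : ℝ, 0 ≤ M ∧ ∀ K : Set (Euc n), ∀ ε : ℝ, 0 < ε →
    ∃ η : Euc n → ℝ,
    ContDiff ℝ (⊤ : ℕ∞) η ∧ (∀ x ∈ thickening ε K, η x = 1) ∧
    (∀ x ∉ thickening (3 * ε) K, η x = 0) ∧
    ∀ j ≤ N, ∀ x, ‖iteratedFDeriv ℝ j η x‖ ≤ M * (ε⁻¹) ^ j := by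
  obtain ⟨M, hM, h⟩ := cutoff_unit n N
  refine ⟨M, hM, fun K ε hε => ?_⟩
  obtain ⟨ζ, hζ, h1, h3, hb⟩ := h ((fun x => ε • x) ⁻¹' K)
  have key : ∀ (x : Euc n) (c : ℝ), ε⁻¹ • x ∈ thickening c ((fun x => ε • x) ⁻¹' K) ↔
      x ∈ thickening (c * ε) K := by
    intro x c
    have hd : ∀ z : Euc n, dist (ε⁻¹ • x) z = ε⁻¹ * dist x (ε • z) := by
      intro z
      have : z = ε⁻¹ • (ε • z) := by rw [smul_smul, inv_mul_cancel₀ hε.ne', one_smul]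
      conv_lhs => rw [this]
      rw [dist_smul₀, Real.norm_of_nonneg (by positivity)]
    rw [mem_thickening_iff, mem_thickening_iff]
    constructor
    · rintro ⟨z, hz, hlt⟩
      refine ⟨ε • z, hz, ?_⟩
      rw [hd, inv_mul_lt_iff₀ hε] at hlt
      linarith
    · rintro ⟨z, hz, hlt⟩
      refine ⟨ε⁻¹ • z, ?_, ?_⟩
      · simpa [smul_smul, hε.ne'] using hz
      · rw [hd, inv_mul_lt_iff₀ hε, smul_smul, mul_inv_cancel₀ hε.ne', one_smul]
        linarith
  refine ⟨fun x => ζ (ε⁻¹ • x), hζ.comp (contDiff_const_smul _), fun x hx => h1 _ ?_,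
    fun x hx => h3 _ ?_, fun j hj x => ?_⟩
  · rw [key]; simpa using hx
  · rw [key]; exact hx
  · rw [iteratedFDeriv_comp_const_smul _ (hζ.of_le (by exact_mod_cast le_top)), norm_smul, norm_pow,
      Real.norm_of_nonneg (by positivity), mul_comm]
    gcongr
    exact hb j hj _

theorem taylor_bound {n m : ℕ} {F : Euc n → ℝ} (hF : ContDiff ℝ m F) {p : Euc n}
    (hz : ∀ i ≤ m, iteratedFDeriv ℝ i F p = 0) {d B : ℝ} (hd : 0 < d) (hB0 : 0 ≤ B)
    (hB : ∀ x ∈ ball p d, ‖iteratedFDeriv ℝ m F x‖ ≤ B) (j : ℕ) :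
    ∀ i, i + j = m → ∀ x ∈ ball p d, ‖iteratedFDeriv ℝ i F x‖ ≤ B * d ^ j := by
  induction j with
  | zero =>
    rintro i rfl x hx
    simpa using hB x hx
  | succ j ih =>
    intro i hij x hx
    have hdiff : Differentiable ℝ (iteratedFDeriv ℝ i F) :=
      hF.differentiable_iteratedFDeriv (by exact_mod_cast (by omega : i < m))
    have := Convex.norm_image_sub_le_of_norm_fderiv_le (𝕜 := ℝ) (s := ball p d)
      (f := iteratedFDeriv ℝ i F) (C := B * d ^ j) (fun y _ => hdiff y)
      (fun y hy => by
        rw [norm_fderiv_iteratedFDeriv]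
        exact ih (i+1) (by omega) y hy) (convex_ball p d) (mem_ball_self hd) hx
    rw [hz i (by omega), sub_zero] at this
    refine this.trans ?_
    rw [pow_succ, ← mul_assoc]
    gcongr
    rw [mem_ball, dist_eq_norm] at hx
    exact hx.le

theorem leibniz_bound {n m : ℕ} {f g : Euc n → ℝ} (hf : ContDiff ℝ m f) (hg : ContDiff ℝ m g)
    {x : Euc n} {ε P Q : ℝ} (hε : 0 < ε) (hP : 0 ≤ P) (hQ : 0 ≤ Q)
    (h1 : ∀ a ≤ m, ‖iteratedFDeriv ℝ a f x‖ ≤ P * ε ^ (m - a))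
    (h2 : ∀ b ≤ m, ‖iteratedFDeriv ℝ b g x‖ ≤ Q * (ε⁻¹) ^ b) (i : ℕ) (hi : i ≤ m) :
    ‖iteratedFDeriv ℝ i (fun y => f y * g y) x‖ ≤ 2 ^ m * P * Q * ε ^ (m - i) := by
  refine (norm_iteratedFDeriv_mul_le hf hg x (by exact_mod_cast hi)).trans ?_
  calc _ ≤ ∑ a ∈ Finset.range (i+1), (i.choose a : ℝ) * (P * Q * ε ^ (m - i)) := by
        refine Finset.sum_le_sum fun a ha => ?_
        have ha' : a ≤ i := by simpa [Nat.lt_succ_iff] using ha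
        rw [mul_assoc]
        refine mul_le_mul_of_nonneg_left ?_ (by positivity)
        calc _ ≤ (P * ε ^ (m - a)) * (Q * (ε⁻¹) ^ (i - a)) := by
              gcongr
              · exact h1 a (by omega)
              · exact h2 _ (by omega)
          _ = _ := by
              have : m - a = (m - i) + (i - a) := by omega
              rw [this, pow_add, inv_pow]
              field_simp
    _ = 2 ^ i * (P * Q * ε ^ (m - i)) := by
        rw [← Finset.sum_mul]
        congr 1
        exact_mod_cast Nat.sum_range_choose i
    _ ≤ _ := by
        rw [mul_assoc (2 ^ m * P), mul_assoc (2 ^ m), ← mul_assoc P]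
        gcongr
        norm_num

theorem rpow_interp {ε t γ : ℝ} (hε : 0 < ε) (ht : 0 ≤ t) (hte : t ≤ ε) (hγ0 : 0 < γ) (hγ1 : γ ≤ 1) :
    ε ^ γ * t ≤ ε * t ^ γ := by
  rcases ht.eq_or_lt with rfl | ht
  · simp [Real.zero_rpow hγ0.ne']
  have e1 : ε = ε ^ γ * ε ^ (1 - γ) := by
    rw [← Real.rpow_add hε]; simp
  have e2 : t = t ^ γ * t ^ (1 - γ) := by
    rw [← Real.rpow_add ht]; simp
  have h : t ^ (1 - γ) ≤ ε ^ (1 - γ) := Real.rpow_le_rpow ht.le hte (by linarith)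
  calc ε ^ γ * t = ε ^ γ * (t ^ γ * t ^ (1 - γ)) := by rw [← e2]
    _ ≤ ε ^ γ * (t ^ γ * ε ^ (1 - γ)) := by gcongr
    _ = (ε ^ γ * ε ^ (1 - γ)) * t ^ γ := by ring
    _ = _ := by rw [← e1]

section est
variable {n m : ℕ} {γ : ℝ} {K : Set (Euc n)} {F η : Euc n → ℝ} {ω ε M : ℝ}

theorem F_bound (hγ1 : γ ≤ 1) (hF : ContDiff ℝ m F)
    (hzero : ∀ x ∈ K, ∀ i ≤ m, iteratedFDeriv ℝ i F x = 0) (hω : 0 ≤ ω) (hε : 0 < ε)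
    (hb : ∀ p ∈ K, ∀ x ∈ ball p (4 * ε), ‖iteratedFDeriv ℝ m F x‖ ≤ ω * (4 * ε) ^ γ)
    {x : Euc n} (hx : x ∈ thickening (4 * ε) K) (i : ℕ) (hi : i ≤ m) :
    ‖iteratedFDeriv ℝ i F x‖ ≤ ω * 4 ^ (m + 1) * ε ^ γ * ε ^ (m - i) := by
  obtain ⟨p, hp, hxp⟩ := mem_thickening_iff.1 hx
  refine (taylor_bound hF (hzero p hp) (by positivity : 0 < 4 * ε) (by positivity) (hb p hp)
    (m - i) i (by omega) x hxp).trans ?_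
  rw [Real.mul_rpow (by norm_num) hε.le, mul_pow]
  have h4 : (4:ℝ) ^ γ ≤ 4 := by
    simpa using Real.rpow_le_rpow_of_exponent_le (by norm_num : (1:ℝ) ≤ 4) hγ1
  have h4' : (4:ℝ) ^ (m - i) ≤ 4 ^ m := pow_le_pow_right₀ (by norm_num) (by omega)
  calc _ = ω * (4 ^ γ * 4 ^ (m - i)) * ε ^ γ * ε ^ (m - i) := by ring
    _ ≤ ω * (4 * 4 ^ m) * ε ^ γ * ε ^ (m - i) := by gcongr
    _ = _ := by ring

theorem prod_bound (hF : ContDiff ℝ m F) (hη : ContDiff ℝ (⊤ : ℕ∞) η) (hω : 0 ≤ ω) (hε : 0 < ε)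
    (hM : 0 ≤ M)
    (hFb : ∀ x ∈ thickening (4 * ε) K, ∀ i ≤ m,
      ‖iteratedFDeriv ℝ i F x‖ ≤ ω * 4 ^ (m + 1) * ε ^ γ * ε ^ (m - i))
    (hηb : ∀ j ≤ m + 1, ∀ x, ‖iteratedFDeriv ℝ j η x‖ ≤ M * (ε⁻¹) ^ j)
    (hsup : tsupport η ⊆ cthickening (3 * ε) K) (x : Euc n) (i : ℕ) (hi : i ≤ m) :
    ‖iteratedFDeriv ℝ i (fun y => F y * η y) x‖ ≤
      2 ^ m * (ω * 4 ^ (m + 1) * ε ^ γ) * M * ε ^ (m - i) := by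
  have hεγ := Real.rpow_nonneg hε.le γ
  by_cases hx : x ∈ thickening (4 * ε) K
  · exact leibniz_bound hF (hη.of_le (by exact_mod_cast le_top)) hε (by positivity) hM (hFb x hx)
      (fun b hb => hηb b (by omega) x) i hi
  · have : iteratedFDeriv ℝ i (fun y => F y * η y) x = 0 := by
      by_contra hne
      have h1 : x ∈ tsupport (fun y => F y * η y) :=
        support_iteratedFDeriv_subset (𝕜 := ℝ) i (Function.mem_support.2 hne)
      have h2 : x ∈ tsupport η := closure_mono (Function.support_mul_subset_right F η) h1
      exact hx (cthickening_subset_thickening' (by positivity) (by linarith) _ (hsup h2))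
    rw [this, norm_zero]
    positivity

theorem holder_bound_aux (hγ0 : 0 < γ) (hγ1 : γ ≤ 1)
    (hF : ContDiff ℝ m F) (hη : ContDiff ℝ (⊤ : ℕ∞) η) (hω : 0 ≤ ω) (hε : 0 < ε)
    (hM : 0 ≤ M)
    (hFb : ∀ x ∈ thickening (4 * ε) K, ∀ i ≤ m,
      ‖iteratedFDeriv ℝ i F x‖ ≤ ω * 4 ^ (m + 1) * ε ^ γ * ε ^ (m - i))
    (hFh : ∀ x ∈ thickening (4 * ε) K, ∀ y ∈ thickening (4 * ε) K,
      ‖iteratedFDeriv ℝ m F x - iteratedFDeriv ℝ m F y‖ ≤ ω * ‖x - y‖ ^ γ)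
    (hηb : ∀ j ≤ m + 1, ∀ x, ‖iteratedFDeriv ℝ j η x‖ ≤ M * (ε⁻¹) ^ j)
    (x h : Euc n) (hh : ‖h‖ < ε) (hball : ball x ε ⊆ thickening (4 * ε) K) :
    ‖iteratedFDeriv ℝ m (fun y => F y * η y) (x + h) - iteratedFDeriv ℝ m (fun y => F y * η y) x‖ ≤
      2 * (2 ^ m * (ω * 4 ^ (m + 1)) * M) * ‖h‖ ^ γ := by
  have hεγ := Real.rpow_nonneg hε.le γ
  have hhγ := Real.rpow_nonneg (norm_nonneg h) γ
  have hηm : ContDiff ℝ m η := hη.of_le (by exact_mod_cast le_top)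
  have hadd : ContDiff ℝ m (fun y : Euc n => y + h) := contDiff_id.add contDiff_const
  have hFt : ContDiff ℝ m (fun y => F (y + h)) := hF.comp hadd
  have hηt : ContDiff ℝ m (fun y => η (y + h)) := hηm.comp hadd
  have hx : x ∈ ball x ε := mem_ball_self hε
  have hxh : x + h ∈ ball x ε := by simpa [mem_ball, dist_eq_norm] using hh
  have interp := rpow_interp hε (norm_nonneg h) hh.le hγ0 hγ1
  -- difference of F
  have hd1 : ∀ a ≤ m, ‖iteratedFDeriv ℝ a (fun y => F (y + h) - F y) x‖ ≤
      (ω * 4 ^ (m + 1) * ‖h‖ ^ γ) * ε ^ (m - a) := by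
    intro a ha
    have ham : ((a : ℕ) : WithTop ℕ∞) ≤ m := by exact_mod_cast ha
    rw [fun_iteratedFDeriv_sub_apply (hFt.of_le ham).contDiffAt (hF.of_le ham).contDiffAt,
      iteratedFDeriv_comp_add_right]
    rcases ha.eq_or_lt with rfl | hlt
    · refine (hFh _ (hball hxh) _ (hball hx)).trans ?_
      simp only [add_sub_cancel_left, Nat.sub_self, pow_zero, mul_one]
      have : (1:ℝ) ≤ 4 ^ (a + 1) := one_le_pow₀ (by norm_num)
      gcongr
      exact le_mul_of_one_le_right hω this
    · have hdiff : Differentiable ℝ (iteratedFDeriv ℝ a F) :=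
        hF.differentiable_iteratedFDeriv (by exact_mod_cast hlt)
      have := Convex.norm_image_sub_le_of_norm_fderiv_le (𝕜 := ℝ) (s := ball x ε)
        (f := iteratedFDeriv ℝ a F) (fun y _ => hdiff y)
        (fun y hy => by
          rw [norm_fderiv_iteratedFDeriv]
          exact hFb y (hball hy) (a+1) (by omega)) (convex_ball x ε) hx hxh
      refine this.trans ?_
      have e : m - a = (m - (a + 1)) + 1 := by omega
      rw [e, pow_succ, add_sub_cancel_left]
      calc _ = ω * 4 ^ (m + 1) * ε ^ (m - (a + 1)) * (ε ^ γ * ‖h‖) := by ring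
        _ ≤ ω * 4 ^ (m + 1) * ε ^ (m - (a + 1)) * (ε * ‖h‖ ^ γ) := by gcongr
        _ = _ := by ring
  have hd2 : ∀ b ≤ m, ‖iteratedFDeriv ℝ b (fun y => η (y + h) - η y) x‖ ≤
      (M * ε⁻¹ * ‖h‖) * (ε⁻¹) ^ b := by
    intro b hb
    have hbm : ((b : ℕ) : WithTop ℕ∞) ≤ m := by exact_mod_cast hb
    rw [fun_iteratedFDeriv_sub_apply (hηt.of_le hbm).contDiffAt (hηm.of_le hbm).contDiffAt,
      iteratedFDeriv_comp_add_right]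
    have hdiff : Differentiable ℝ (iteratedFDeriv ℝ b η) :=
      hη.differentiable_iteratedFDeriv (by exact_mod_cast WithTop.coe_lt_top b)
    have := Convex.norm_image_sub_le_of_norm_fderiv_le (𝕜 := ℝ) (s := univ)
        (f := iteratedFDeriv ℝ b η) (fun y _ => hdiff y)
        (fun y hy => by
          rw [norm_fderiv_iteratedFDeriv]
          exact hηb (b+1) (by omega) y) convex_univ (mem_univ x) (mem_univ (x + h))
    refine this.trans (le_of_eq ?_)
    rw [add_sub_cancel_left]
    ring
  have hFη : ContDiff ℝ m (fun y => F y * η y) := hF.mul hηm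
  have hFηt : ContDiff ℝ m (fun y => F (y + h) * η (y + h)) := hFt.mul hηt
  have hA := leibniz_bound (hFt.sub hF) hηt hε (by positivity) hM hd1
    (fun b hb => by rw [iteratedFDeriv_comp_add_right]; exact hηb b (by omega) _) m le_rfl
  have hB := leibniz_bound hF (hηt.sub hηm) hε (by positivity) (by positivity)
    (hFb x (hball hx)) hd2 m le_rfl
  have heq : iteratedFDeriv ℝ m (fun y => F y * η y) (x + h) -
      iteratedFDeriv ℝ m (fun y => F y * η y) x =
      iteratedFDeriv ℝ m (fun y => (F (y + h) - F y) * η (y + h)) x +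
      iteratedFDeriv ℝ m (fun y => F y * (η (y + h) - η y)) x := by
    rw [← iteratedFDeriv_comp_add_right (f := fun y => F y * η y) m h x,
      ← fun_iteratedFDeriv_sub_apply hFηt.contDiffAt hFη.contDiffAt,
      ← fun_iteratedFDeriv_add_apply ((hFt.sub hF).mul hηt).contDiffAt
        (hF.mul (hηt.sub hηm)).contDiffAt]
    congr 1
    funext y
    ring
  rw [heq]
  refine (norm_add_le _ _).trans ((add_le_add hA hB).trans ?_)
  simp only [Nat.sub_self, pow_zero, mul_one]
  have : ε ^ γ * (ε⁻¹ * ‖h‖) ≤ ‖h‖ ^ γ := by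
    rw [mul_left_comm, inv_mul_le_iff₀ hε]
    exact interp
  calc _ = 2 ^ m * (ω * 4 ^ (m + 1)) * M * ‖h‖ ^ γ +
        2 ^ m * (ω * 4 ^ (m + 1)) * M * (ε ^ γ * (ε⁻¹ * ‖h‖)) := by ring
    _ ≤ 2 ^ m * (ω * 4 ^ (m + 1)) * M * ‖h‖ ^ γ +
        2 ^ m * (ω * 4 ^ (m + 1)) * M * ‖h‖ ^ γ := by gcongr
    _ = _ := by ring

theorem holder_bound (hγ0 : 0 < γ) (hγ1 : γ ≤ 1)
    (hF : ContDiff ℝ m F) (hη : ContDiff ℝ (⊤ : ℕ∞) η) (hω : 0 ≤ ω) (hε : 0 < ε)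
    (hM : 0 ≤ M)
    (hFb : ∀ x ∈ thickening (4 * ε) K, ∀ i ≤ m,
      ‖iteratedFDeriv ℝ i F x‖ ≤ ω * 4 ^ (m + 1) * ε ^ γ * ε ^ (m - i))
    (hFh : ∀ x ∈ thickening (4 * ε) K, ∀ y ∈ thickening (4 * ε) K,
      ‖iteratedFDeriv ℝ m F x - iteratedFDeriv ℝ m F y‖ ≤ ω * ‖x - y‖ ^ γ)
    (hηb : ∀ j ≤ m + 1, ∀ x, ‖iteratedFDeriv ℝ j η x‖ ≤ M * (ε⁻¹) ^ j)
    (hsup : tsupport η ⊆ cthickening (3 * ε) K) (x y : Euc n) :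
    ‖iteratedFDeriv ℝ m (fun y => F y * η y) x - iteratedFDeriv ℝ m (fun y => F y * η y) y‖ ≤
      2 * (2 ^ m * (ω * 4 ^ (m + 1)) * M) * ‖x - y‖ ^ γ := by
  have hball : ∀ x ∈ cthickening (3 * ε) K, ball x ε ⊆ thickening (4 * ε) K := by
    intro x hx y hy
    rw [mem_ball] at hy
    have := cthickening_subset_thickening' (δ₂ := 4 * ε - dist y x) (by linarith)
      (by linarith) K hx
    obtain ⟨z, hz, hxz⟩ := mem_thickening_iff.1 this
    exact mem_thickening_iff.2 ⟨z, hz, by linarith [dist_triangle y x z]⟩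
  have hz : ∀ x, x ∉ cthickening (3 * ε) K →
      iteratedFDeriv ℝ m (fun y => F y * η y) x = 0 := by
    intro x hx
    by_contra hne
    have h1 : x ∈ tsupport (fun y => F y * η y) :=
      support_iteratedFDeriv_subset (𝕜 := ℝ) m (Function.mem_support.2 hne)
    exact hx (hsup (closure_mono (Function.support_mul_subset_right F η) h1))
  rcases lt_or_ge ‖x - y‖ ε with hlt | hge
  · by_cases hy : y ∈ cthickening (3 * ε) K
    · have := holder_bound_aux hγ0 hγ1 hF hη hω hε hM hFb hFh hηb y (x - y) hlt (hball y hy)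
      simpa using this
    by_cases hx : x ∈ cthickening (3 * ε) K
    · rw [norm_sub_rev] at hlt
      have := holder_bound_aux hγ0 hγ1 hF hη hω hε hM hFb hFh hηb x (y - x) hlt (hball x hx)
      rw [norm_sub_rev x y, norm_sub_rev (iteratedFDeriv ℝ m (fun y => F y * η y) x)]
      simpa using this
    · rw [hz x hx, hz y hy, sub_self, norm_zero]
      have := Real.rpow_nonneg (norm_nonneg (x - y)) γ
      positivity
  · have b := fun z => prod_bound hF hη hω hε hM hFb hηb hsup z m le_rfl
    have hp : ε ^ γ ≤ ‖x - y‖ ^ γ := Real.rpow_le_rpow hε.le hge hγ0.le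
    refine (norm_sub_le _ _).trans ((add_le_add (b x) (b y)).trans ?_)
    simp only [Nat.sub_self, pow_zero, mul_one]
    calc _ = 2 * (2 ^ m * (ω * 4 ^ (m + 1)) * M) * ε ^ γ := by ring
      _ ≤ _ := by gcongr

end est

theorem le_of_eHolder {n : ℕ} {Y : Type} [NormedAddCommGroup Y] {γ ω : ℝ} (hγ : 0 < γ) (hω : 0 ≤ ω)
    {f : Euc n → Y} {E : Set (Euc n)} (h : eHolder γ f E ≤ ENNReal.ofReal ω)
    {x y : Euc n} (hx : x ∈ E) (hy : y ∈ E) : ‖f x - f y‖ ≤ ω * ‖x - y‖ ^ γ := by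
  rcases eq_or_ne x y with rfl | hne
  · simp [Real.zero_rpow hγ.ne']
  have h1 : edist (f x) (f y) / edist x y ^ γ ≤ ENNReal.ofReal ω := by
    refine le_trans ?_ h
    unfold eHolder
    exact le_iSup_of_le x (le_iSup_of_le hx (le_iSup_of_le y (le_iSup_of_le hy
      (le_iSup_of_le hne le_rfl))))
  have hpos : 0 < ‖x - y‖ := norm_pos_iff.2 (sub_ne_zero.2 hne)
  have hpγ : 0 < ‖x - y‖ ^ γ := Real.rpow_pos_of_pos hpos γ
  rw [edist_dist, edist_dist, dist_eq_norm, dist_eq_norm, ENNReal.ofReal_rpow_of_pos hpos,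
    ← ENNReal.ofReal_div_of_pos hpγ, ENNReal.ofReal_le_ofReal_iff hω, div_le_iff₀ hpγ] at h1
  exact h1

theorem eHolder_le {n : ℕ} {Y : Type} [NormedAddCommGroup Y] {γ C : ℝ}
    {f : Euc n → Y} (h : ∀ x y, ‖f x - f y‖ ≤ C * ‖x - y‖ ^ γ) (E : Set (Euc n)) :
    eHolder γ f E ≤ ENNReal.ofReal C := by
  unfold eHolder
  refine iSup_le fun x => iSup_le fun _ => iSup_le fun y => iSup_le fun _ => iSup_le fun hne => ?_
  have hpos : 0 < ‖x - y‖ := norm_pos_iff.2 (sub_ne_zero.2 hne)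
  have hpγ : 0 < ‖x - y‖ ^ γ := Real.rpow_pos_of_pos hpos γ
  rw [edist_dist, edist_dist, dist_eq_norm, dist_eq_norm, ENNReal.ofReal_rpow_of_pos hpos,
    ← ENNReal.ofReal_div_of_pos hpγ]
  apply ENNReal.ofReal_le_ofReal
  rw [div_le_iff₀ hpγ]
  exact h x y

theorem choose_radius
    (n m : ℕ) (γ : ℝ) (hγ0 : 0 ≤ γ)
    (K : Set (Euc n))
    (F : Euc n → ℝ) (hF : ContDiff ℝ m F) (hsupp : HasCompactSupport F)
    (hzero : ∀ x ∈ K, ∀ i ≤ m, iteratedFDeriv ℝ i F x = 0)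
    (hlim : 0 < γ → Tendsto (fun ε => eHolder γ (iteratedFDeriv ℝ m F)
      (Metric.thickening ε K)) (𝓝[>] (0 : ℝ)) (𝓝 0)) (ω : ℝ) (hω : 0 < ω) :
    ∃ ε : ℝ, 0 < ε ∧ ε ≤ 1 ∧
      (∀ p ∈ K, ∀ x ∈ ball p (4 * ε), ‖iteratedFDeriv ℝ m F x‖ ≤ ω * (4 * ε) ^ γ) ∧
      (0 < γ → ∀ x ∈ thickening (4 * ε) K, ∀ y ∈ thickening (4 * ε) K,
        ‖iteratedFDeriv ℝ m F x - iteratedFDeriv ℝ m F y‖ ≤ ω * ‖x - y‖ ^ γ) := by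
  rcases hγ0.eq_or_lt with rfl | hγ
  · have hc : Continuous (iteratedFDeriv ℝ m F) := hF.continuous_iteratedFDeriv le_rfl
    have huc : UniformContinuous (iteratedFDeriv ℝ m F) :=
      (hsupp.iteratedFDeriv m).uniformContinuous_of_continuous hc
    obtain ⟨δ, hδ, h⟩ := Metric.uniformContinuous_iff.1 huc ω hω
    refine ⟨min (δ / 4) 1, by positivity, min_le_right _ _, ?_, fun h => absurd h (lt_irrefl _)⟩
    intro p hp x hx
    have hlt : dist x p < δ := by
      rw [mem_ball] at hx
      linarith [min_le_left (δ / 4) 1]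
    have := h hlt
    rw [hzero p hp m le_rfl, dist_zero_right] at this
    simpa using this.le
  · have hev : ∀ᶠ r in 𝓝[>] (0:ℝ), eHolder γ (iteratedFDeriv ℝ m F) (thickening r K)
        < ENNReal.ofReal ω := (hlim hγ).eventually (gt_mem_nhds (by simpa using hω))
    obtain ⟨r, hr, hr0⟩ := (hev.and (Ioo_mem_nhdsGT (zero_lt_one' ℝ))).exists
    have hr' : 4 * (r / 4) = r := by ring
    refine ⟨r / 4, by linarith [hr0.1], by linarith [hr0.2], ?_, ?_⟩
    · rw [hr']
      intro p hp x hx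
      have := le_of_eHolder hγ hω.le hr.le (mem_thickening_iff.2 ⟨p, hp, hx⟩)
        (self_subset_thickening hr0.1 K hp)
      rw [hzero p hp m le_rfl, sub_zero] at this
      refine this.trans ?_
      rw [mem_ball, dist_eq_norm] at hx
      gcongr
    · rw [hr']
      intro _ x hx y hy
      exact le_of_eHolder hγ hω.le hr.le hx hy

/-- **Approximation in `C^{m,γ}` by cutoff** (Theorem 3.2). Let `K ⊂ ℝⁿ` be compact and
`F ∈ C_c^{m,γ}(ℝⁿ)` with `D^j F = 0` on `K` for `0 ≤ |j| ≤ m` and, if `γ > 0`,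
`|∇^m F|_{C^{0,γ}(K_ε)} → 0` as `ε → 0⁺`. Then there are smooth cutoff functions `η_k`,
each equal to `1` on a neighbourhood of `K`, such that `F_k := F(1-η_k)` is supported in
`Kᶜ` and `F_k → F` in the `C^{m,γ}` norm. -/
theorem hedberg_Cm_gamma
    (n m : ℕ) (γ : ℝ) (hγ0 : 0 ≤ γ) (hγ1 : γ ≤ 1)
    (K : Set (Euc n)) (hK : IsCompact K)
    (F : Euc n → ℝ) (hF : ContDiff ℝ m F) (hsupp : HasCompactSupport F)
    (hFγ : 0 < γ → eHolder γ (iteratedFDeriv ℝ m F) Set.univ < ⊤)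
    (hzero : ∀ x ∈ K, ∀ i ≤ m, iteratedFDeriv ℝ i F x = 0)
    (hlim : 0 < γ → Tendsto (fun ε => eHolder γ (iteratedFDeriv ℝ m F)
      (Metric.thickening ε K)) (𝓝[>] (0 : ℝ)) (𝓝 0)) :
    ∃ η : ℕ → Euc n → ℝ,
      (∀ k, ContDiff ℝ (⊤ : ℕ∞) (η k) ∧ HasCompactSupport (η k) ∧
        ∃ U : Set (Euc n), IsOpen U ∧ K ⊆ U ∧ ∀ x ∈ U, η k x = 1) ∧
      (∀ k, tsupport (fun x => F x * (1 - η k x)) ⊆ Kᶜ) ∧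
      (∀ i ≤ m, TendstoUniformly
        (fun k => iteratedFDeriv ℝ i (fun x => F x * (1 - η k x)))
        (iteratedFDeriv ℝ i F) atTop) ∧
      (0 < γ → Tendsto (fun k => eHolder γ
          (fun x => iteratedFDeriv ℝ m (fun y => F y * (1 - η k y)) x -
            iteratedFDeriv ℝ m F x) Set.univ)
        atTop (𝓝 0)) := by
  obtain ⟨M, hM, hcut⟩ := cutoff_scaled n (m + 1)
  have hωpos : ∀ k : ℕ, (0:ℝ) < 1 / ((k:ℝ) + 1) := fun k => by positivity
  have hωlim : Tendsto (fun k : ℕ => (1:ℝ) / ((k:ℝ) + 1)) atTop (𝓝 0) :=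
    tendsto_one_div_add_atTop_nhds_zero_nat
  generalize hωdef : (fun k : ℕ => (1:ℝ) / ((k:ℝ) + 1)) = ω at hωlim
  replace hωpos : ∀ k, 0 < ω k := fun k => by rw [← hωdef]; exact hωpos k
  choose ε hε hε1 hb hh using fun k => choose_radius n m γ hγ0 K F hF hsupp hzero hlim (ω k) (hωpos k)
  choose η hη hη1 hη0 hηb using fun k => hcut K (ε k) (hε k)
  have hηm : ∀ k, ContDiff ℝ m (η k) := fun k => (hη k).of_le (by exact_mod_cast le_top)
  have hsup : ∀ k, tsupport (η k) ⊆ cthickening (3 * ε k) K := by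
    intro k
    refine (closure_mono ?_).trans (closure_thickening_subset_cthickening (3 * ε k) K)
    intro x hx
    by_contra hn
    exact hx (hη0 k x hn)
  have hFb : ∀ k, ∀ x ∈ thickening (4 * ε k) K, ∀ i ≤ m,
      ‖iteratedFDeriv ℝ i F x‖ ≤ ω k * 4 ^ (m + 1) * (ε k) ^ γ * (ε k) ^ (m - i) :=
    fun k x hx i hi => F_bound hγ1 hF hzero (hωpos k).le (hε k) (hb k) hx i hi
  have hdiff : ∀ k, ∀ i ≤ m, ∀ x, iteratedFDeriv ℝ i (fun y => F y * (1 - η k y)) x =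
      iteratedFDeriv ℝ i F x - iteratedFDeriv ℝ i (fun y => F y * η k y) x := by
    intro k i hi x
    have him : ((i : ℕ) : WithTop ℕ∞) ≤ m := by exact_mod_cast hi
    rw [← fun_iteratedFDeriv_sub_apply (hF.of_le him).contDiffAt
      ((hF.mul (hηm k)).of_le him).contDiffAt]
    congr 1
    funext y
    ring
  refine ⟨η, fun k => ⟨hη k, ?_, thickening (ε k) K, isOpen_thickening,
    self_subset_thickening (hε k) K, hη1 k⟩, ?_, ?_, ?_⟩
  · exact (hK.cthickening).of_isClosed_subset (isClosed_tsupport _) (hsup k)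
  · intro k x hx hxK
    have hcl : tsupport (fun x => F x * (1 - η k x)) ⊆ (thickening (ε k) K)ᶜ := by
      refine closure_minimal ?_ isOpen_thickening.isClosed_compl
      intro y hy hyt
      apply hy
      simp [hη1 k y hyt]
    exact hcl hx (self_subset_thickening (hε k) K hxK)
  · intro i hi
    rw [Metric.tendstoUniformly_iff]
    intro δ hδ
    have hl : Tendsto (fun k => 2 ^ m * (ω k * 4 ^ (m + 1)) * M) atTop (𝓝 0) := by
      have := ((hωlim.mul_const ((4:ℝ) ^ (m + 1))).const_mul ((2:ℝ) ^ m)).mul_const M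
      simpa using this
    filter_upwards [hl.eventually (gt_mem_nhds hδ)] with k hk x
    rw [hdiff k i hi x, dist_eq_norm, sub_sub_cancel]
    refine lt_of_le_of_lt ((prod_bound hF (hη k) (hωpos k).le (hε k) hM (hFb k) (hηb k) (hsup k)
      x i hi).trans ?_) hk
    have h1 : (ε k) ^ γ ≤ 1 := Real.rpow_le_one (hε k).le (hε1 k) hγ0
    have h2 : (ε k) ^ (m - i) ≤ 1 := pow_le_one₀ (hε k).le (hε1 k)
    have h0 := Real.rpow_nonneg (hε k).le γ
    have hw := (hωpos k).le
    have he := (hε k).le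
    calc _ = 2 ^ m * (ω k * 4 ^ (m + 1)) * M * ((ε k) ^ γ * (ε k) ^ (m - i)) := by ring
      _ ≤ 2 ^ m * (ω k * 4 ^ (m + 1)) * M * (1 * 1) := by gcongr
      _ = _ := by ring
  · intro hγ
    have hl : Tendsto (fun k => ENNReal.ofReal (2 * (2 ^ m * (ω k * 4 ^ (m + 1)) * M)))
        atTop (𝓝 0) := by
      have := (((hωlim.mul_const ((4:ℝ) ^ (m + 1))).const_mul ((2:ℝ) ^ m)).mul_const M).const_mul 2
      have := ENNReal.tendsto_ofReal this
      simpa using this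
    refine tendsto_of_tendsto_of_tendsto_of_le_of_le tendsto_const_nhds hl (fun _ => zero_le) ?_
    intro k
    refine eHolder_le (fun x y => ?_) _
    have := holder_bound hγ hγ1 hF (hη k) (hωpos k).le (hε k) hM (hFb k) (hh k hγ) (hηb k)
      (hsup k) x y
    refine le_trans (le_of_eq ?_) this
    rw [hdiff k m le_rfl x, hdiff k m le_rfl y, ← norm_neg]
    congr 1
    abel

end DFA
end
end

section
/- For every θ ∈ (1/2, 1] there exist a constant C > 0 and a curve g : [0,1] → ℝ² such that C^{−1}|s−t|^θ ≤ |g(s)−g(t)| ≤ C|s−t|^θ for all s,t ∈ [0,1]. -/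
open MeasureTheory Filter Topology Metric Set
open scoped ENNReal NNReal Classical

noncomputable section

namespace DFA

/-- The triangle with vertices `0`, `1`, `1/2 + ih`. -/
def Tri (h : ℝ) (z : ℂ) : Prop :=
  0 ≤ z.im ∧ z.im ≤ 2 * h * z.re ∧ z.im ≤ 2 * h * (1 - z.re) ∧ 0 ≤ z.re ∧ z.re ≤ 1

def fL (h : ℝ) (z : ℂ) : ℂ := ⟨z.re / 2 + h * z.im, h * z.re - z.im / 2⟩
def fR (h : ℝ) (z : ℂ) : ℂ := ⟨1 / 2 + z.re / 2 - h * z.im, h - h * z.re - z.im / 2⟩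

theorem norm_fL (h r : ℝ) (hr : 0 ≤ r) (hrh : r ^ 2 = 1 / 4 + h ^ 2) (z w : ℂ) :
    ‖fL h z - fL h w‖ = r * ‖z - w‖ := by
  rw [← sq_eq_sq₀ (norm_nonneg _) (by positivity), mul_pow, Complex.sq_norm, Complex.sq_norm,
    Complex.normSq_apply, Complex.normSq_apply, hrh]
  simp [fL]; ring

theorem norm_fR (h r : ℝ) (hr : 0 ≤ r) (hrh : r ^ 2 = 1 / 4 + h ^ 2) (z w : ℂ) :
    ‖fR h z - fR h w‖ = r * ‖z - w‖ := by
  rw [← sq_eq_sq₀ (norm_nonneg _) (by positivity), mul_pow, Complex.sq_norm, Complex.sq_norm,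
    Complex.normSq_apply, Complex.normSq_apply, hrh]
  simp [fR]; ring

theorem tri_fL (h : ℝ) (h0 : 0 ≤ h) (h1 : h < 1 / 2) (z : ℂ) (hz : Tri h z) : Tri h (fL h z) := by
  obtain ⟨a, b, c, d, e⟩ := hz
  have k1 : 0 ≤ h * z.im := mul_nonneg h0 a
  have k2 : 0 ≤ h * (h * z.im) := mul_nonneg h0 k1
  have k3 : h * z.im ≤ 1 / 2 * z.im := mul_le_mul_of_nonneg_right h1.le a
  have k4 : h * (h * z.im) ≤ 1 / 2 * (h * z.im) := mul_le_mul_of_nonneg_right h1.le k1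
  have k5 : 0 ≤ h * z.re := mul_nonneg h0 d
  have k6 : 0 ≤ h * (1 - z.re) := mul_nonneg h0 (by linarith)
  have k7 : h * (1 - z.re) ≤ 1 / 2 * (1 - z.re) := mul_le_mul_of_nonneg_right h1.le (by linarith)
  refine ⟨?_, ?_, ?_, ?_, ?_⟩ <;> simp only [fL] <;> nlinarith

theorem tri_fR (h : ℝ) (h0 : 0 ≤ h) (h1 : h < 1 / 2) (z : ℂ) (hz : Tri h z) : Tri h (fR h z) := by
  obtain ⟨a, b, c, d, e⟩ := hz
  have k1 : 0 ≤ h * z.im := mul_nonneg h0 a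
  have k2 : 0 ≤ h * (h * z.im) := mul_nonneg h0 k1
  have k3 : h * z.im ≤ 1 / 2 * z.im := mul_le_mul_of_nonneg_right h1.le a
  have k4 : h * (h * z.im) ≤ 1 / 2 * (h * z.im) := mul_le_mul_of_nonneg_right h1.le k1
  have k5 : 0 ≤ h * z.re := mul_nonneg h0 d
  have k6 : 0 ≤ h * (1 - z.re) := mul_nonneg h0 (by linarith)
  have k7 : h * (1 - z.re) ≤ 1 / 2 * (1 - z.re) := mul_le_mul_of_nonneg_right h1.le (by linarith)
  refine ⟨?_, ?_, ?_, ?_, ?_⟩ <;> simp only [fR] <;> nlinarith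

theorem tri_norm (h : ℝ) (h0 : 0 ≤ h) (h1 : h < 1 / 2) (z : ℂ) (hz : Tri h z) :
    ‖z‖ ≤ 2 ∧ ‖1 - z‖ ≤ 2 := by
  obtain ⟨a, b, c, d, e⟩ := hz
  have k6 : 0 ≤ h * (1 - z.re) := mul_nonneg h0 (by linarith)
  have k7 : h * (1 - z.re) ≤ 1 / 2 * (1 - z.re) := mul_le_mul_of_nonneg_right h1.le (by linarith)
  constructor
  · refine (Complex.norm_le_abs_re_add_abs_im z).trans ?_
    rw [abs_of_nonneg a, abs_of_nonneg d]; linarith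
  · refine (Complex.norm_le_abs_re_add_abs_im _).trans ?_
    simp only [Complex.sub_re, Complex.sub_im, Complex.one_re, Complex.one_im, zero_sub, abs_neg]
    rw [abs_of_nonneg a, abs_of_nonneg (by linarith)]; linarith

/-- Left cone. -/
theorem cone_fL (h c : ℝ) (h0 : 0 ≤ h) (h1 : h < 1 / 2) (hc : c = (1 / 2 - 2 * h ^ 2) / 2)
    (z : ℂ) (hz : Tri h z) :
    (fL h z).im ≤ h ∧ c * (h - (fL h z).im) ≤ 1 / 2 - (fL h z).re := by
  obtain ⟨a, b, c', d, e⟩ := hz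
  have k6 : 0 ≤ h * (1 - z.re) := mul_nonneg h0 (by linarith)
  have cp : 0 < c := by rw [hc]; nlinarith
  simp only [fL]
  constructor
  · nlinarith
  · have e1 : h * z.im ≤ h * (2 * h * (1 - z.re)) := mul_le_mul_of_nonneg_left c' h0
    have e2 : c * z.im ≤ c * (2 * h * (1 - z.re)) := mul_le_mul_of_nonneg_left c' cp.le
    have e3 : c * (2 * h) * (1 - z.re) ≤ c * 1 * (1 - z.re) := by
      apply mul_le_mul_of_nonneg_right _ (by linarith)
      apply mul_le_mul_of_nonneg_left _ cp.le
      linarith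
    have e4 : 2 * (c * (1 - z.re)) = (1 / 2 - 2 * h ^ 2) * (1 - z.re) := by rw [hc]; ring
    have e5 : 0 ≤ c * (1 - z.re) := mul_nonneg cp.le (by linarith)
    nlinarith

theorem cone_fR (h c : ℝ) (h0 : 0 ≤ h) (h1 : h < 1 / 2) (hc : c = (1 / 2 - 2 * h ^ 2) / 2)
    (z : ℂ) (hz : Tri h z) :
    (fR h z).im ≤ h ∧ c * (h - (fR h z).im) ≤ (fR h z).re - 1 / 2 := by
  obtain ⟨a, b, c', d, e⟩ := hz
  have k6 : 0 ≤ h * z.re := mul_nonneg h0 (by linarith)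
  have cp : 0 < c := by rw [hc]; nlinarith
  simp only [fR]
  constructor
  · nlinarith
  · have e1 : h * z.im ≤ h * (2 * h * z.re) := mul_le_mul_of_nonneg_left b h0
    have e2 : c * z.im ≤ c * (2 * h * z.re) := mul_le_mul_of_nonneg_left b cp.le
    have e3 : c * (2 * h) * z.re ≤ c * 1 * z.re := by
      apply mul_le_mul_of_nonneg_right _ (by linarith)
      apply mul_le_mul_of_nonneg_left _ cp.le
      linarith
    have e4 : 2 * (c * z.re) = (1 / 2 - 2 * h ^ 2) * z.re := by rw [hc]; ring
    have e5 : 0 ≤ c * z.re := mul_nonneg cp.le (by linarith)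
    nlinarith

def Gn (h : ℝ) : ℕ → ℝ → ℂ
  | 0, t => (t : ℂ)
  | n + 1, t => if t ≤ 1 / 2 then fL h (Gn h n (2 * t)) else fR h (Gn h n (2 * t - 1))

theorem Gn_tri (h : ℝ) (h0 : 0 ≤ h) (h1 : h < 1 / 2) (n : ℕ) :
    ∀ t ∈ Set.Icc (0 : ℝ) 1, Tri h (Gn h n t) := by
  induction n with
  | zero =>
    rintro t ⟨a, b⟩
    refine ⟨?_, ?_, ?_, ?_, ?_⟩ <;> simp [Gn]
    · positivity
    · exact mul_nonneg (by positivity) (by linarith)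
    · exact a
    · exact b
  | succ n ih =>
    rintro t ⟨a, b⟩
    simp only [Gn]
    split_ifs with ht
    · exact tri_fL h h0 h1 _ (ih _ ⟨by linarith, by linarith⟩)
    · push Not at ht
      exact tri_fR h h0 h1 _ (ih _ ⟨by linarith, by linarith⟩)

theorem Gn_dist (h r : ℝ) (h0 : 0 ≤ h) (h1 : h < 1 / 2) (hr : 0 ≤ r)
    (hrh : r ^ 2 = 1 / 4 + h ^ 2) (n : ℕ) :
    ∀ t ∈ Set.Icc (0 : ℝ) 1, dist (Gn h n t) (Gn h (n + 1) t) ≤ 4 * r ^ n := by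
  induction n with
  | zero =>
    intro t ht
    have e1 := (tri_norm h h0 h1 _ (Gn_tri h h0 h1 0 t ht)).1
    have e2 := (tri_norm h h0 h1 _ (Gn_tri h h0 h1 1 t ht)).1
    rw [dist_eq_norm]
    have := norm_sub_le (Gn h 0 t) (Gn h (0 + 1) t)
    simp at this ⊢
    linarith
  | succ n ih =>
    rintro t ⟨a, b⟩
    rw [Gn, Gn]
    split_ifs with ht
    · rw [dist_eq_norm, norm_fL h r hr hrh, pow_succ]
      have := ih (2 * t) ⟨by linarith, by linarith⟩
      rw [dist_eq_norm] at this
      nlinarith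
    · push Not at ht
      rw [dist_eq_norm, norm_fR h r hr hrh, pow_succ]
      have := ih (2 * t - 1) ⟨by linarith, by linarith⟩
      rw [dist_eq_norm] at this
      nlinarith

theorem cont_fL (h : ℝ) : Continuous (fL h) := by
  have : fL h = fun z : ℂ => ((z.re / 2 + h * z.im : ℝ) : ℂ)
      + ((h * z.re - z.im / 2 : ℝ) : ℂ) * Complex.I := by
    funext z; apply Complex.ext <;> simp [fL]
  rw [this]; fun_prop

theorem cont_fR (h : ℝ) : Continuous (fR h) := by
  have : fR h = fun z : ℂ => ((1 / 2 + z.re / 2 - h * z.im : ℝ) : ℂ)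
      + ((h - h * z.re - z.im / 2 : ℝ) : ℂ) * Complex.I := by
    funext z; apply Complex.ext <;> simp [fR]
  rw [this]; fun_prop

theorem tri_closed (h : ℝ) : IsClosed {z | Tri h z} := by
  unfold Tri
  simp only [Set.ofPred_and]
  refine IsClosed.inter ?_ (IsClosed.inter ?_ (IsClosed.inter ?_ (IsClosed.inter ?_ ?_)))
  all_goals exact isClosed_le (by fun_prop) (by fun_prop)

theorem exists_limit (h r : ℝ) (h0 : 0 ≤ h) (h1 : h < 1 / 2) (hr : 0 ≤ r) (hr1 : r < 1)
    (hrh : r ^ 2 = 1 / 4 + h ^ 2) : ∃ g : ℝ → ℂ, g 0 = 0 ∧ g 1 = 1 ∧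
      (∀ t ∈ Set.Icc (0 : ℝ) 1, Tri h (g t)) ∧
      (∀ t ∈ Set.Icc (0 : ℝ) (1 / 2), g t = fL h (g (2 * t))) ∧
      (∀ t ∈ Set.Icc (1 / 2 : ℝ) 1, g t = fR h (g (2 * t - 1))) := by
  have key : ∀ t : ℝ, ∃ z : ℂ, t ∈ Set.Icc (0 : ℝ) 1 →
      Tendsto (fun n => Gn h n t) atTop (𝓝 z) := by
    intro t
    by_cases ht : t ∈ Set.Icc (0 : ℝ) 1
    · have : CauchySeq (fun n => Gn h n t) :=
        cauchySeq_of_le_geometric r 4 hr1 (fun n => Gn_dist h r h0 h1 hr hrh n t ht)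
      obtain ⟨z, hz⟩ := cauchySeq_tendsto_of_complete this
      exact ⟨z, fun _ => hz⟩
    · exact ⟨0, fun h => absurd h ht⟩
  choose g hg using key
  have z0 : g 0 = 0 := by
    have : ∀ n, Gn h n 0 = 0 := by
      intro n
      induction n with
      | zero => simp [Gn]
      | succ n ih => rw [Gn]; simp [ih, fL]; rfl
    have k := hg 0 (by simp)
    simp only [this] at k
    exact tendsto_nhds_unique k tendsto_const_nhds
  have z1 : g 1 = 1 := by
    have : ∀ n, Gn h n 1 = 1 := by
      intro n
      induction n with
      | zero => simp [Gn]
      | succ n ih =>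
        rw [Gn, if_neg (by norm_num)]
        norm_num [ih, fR]; rfl
    have k := hg 1 (by simp)
    simp only [this] at k
    exact tendsto_nhds_unique k tendsto_const_nhds
  have hL : ∀ t ∈ Set.Icc (0 : ℝ) (1 / 2), g t = fL h (g (2 * t)) := by
    rintro t ⟨a, b⟩
    have k1 := (hg t ⟨a, by linarith⟩).comp (tendsto_add_atTop_nat 1)
    have k2 := ((cont_fL h).tendsto _).comp (hg (2 * t) ⟨by linarith, by linarith⟩)
    refine tendsto_nhds_unique k1 (k2.congr ?_)
    intro n
    simp only [Function.comp, Gn]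
    rw [if_pos b]
  refine ⟨g, z0, z1, ?_, hL, ?_⟩
  · intro t ht
    exact (tri_closed h).mem_of_tendsto (hg t ht)
      (Eventually.of_forall fun n => Gn_tri h h0 h1 n t ht)
  · rintro t ⟨a, b⟩
    rcases a.eq_or_lt with a' | a'
    · subst a'
      rw [hL _ ⟨by norm_num, le_rfl⟩]
      norm_num [z0, z1, fL, fR]
    · have k1 := (hg t ⟨by linarith, by linarith⟩).comp (tendsto_add_atTop_nat 1)
      have k2 := ((cont_fR h).tendsto _).comp (hg (2 * t - 1) ⟨by linarith, by linarith⟩)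
      refine tendsto_nhds_unique k1 (k2.congr ?_)
      intro n
      simp only [Function.comp, Gn]
      rw [if_neg (by linarith)]

theorem scaling (θ r : ℝ) (hθ1 : 1 / 2 < θ) (hθ2 : θ ≤ 1) (hr : r * 2 ^ θ = 1)
    (F : ℝ → ℝ) (F0 : F 0 = 0) (F1 : ∀ u ∈ Set.Icc (0 : ℝ) (1 / 2), F u = r * F (2 * u))
    (F2 : ∀ u ∈ Set.Icc (1 / 2 : ℝ) 1, 1 / 2 ≤ F u ∧ F u ≤ 2) :
    ∀ u ∈ Set.Icc (0 : ℝ) 1, 1 / 2 * u ^ θ ≤ F u ∧ F u ≤ 4 * u ^ θ := by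
  have hr0 : 0 ≤ r := by
    have : (0 : ℝ) < 2 ^ θ := by positivity
    by_contra hh
    push Not at hh
    nlinarith
  have main : ∀ n : ℕ, ∀ u ∈ Set.Icc (0 : ℝ) 1, 1 ≤ 2 ^ n * u →
      1 / 2 * u ^ θ ≤ F u ∧ F u ≤ 4 * u ^ θ := by
    have big : ∀ u ∈ Set.Icc (1 / 2 : ℝ) 1, 1 / 2 * u ^ θ ≤ F u ∧ F u ≤ 4 * u ^ θ := by
      rintro u ⟨a, b⟩
      have e1 : u ^ θ ≤ 1 := Real.rpow_le_one (by linarith) b (by linarith)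
      have e2 : u ≤ u ^ θ := Real.self_le_rpow_of_le_one (by linarith) b hθ2
      have := F2 u ⟨a, b⟩
      constructor <;> linarith
    intro n
    induction n with
    | zero => rintro u ⟨a, b⟩ hu; exact big u ⟨by simp at hu; linarith, b⟩
    | succ n ih =>
      rintro u ⟨a, b⟩ hu
      rcases le_total u (1 / 2) with hh | hh
      · have := ih (2 * u) ⟨by linarith, by linarith⟩ (by rw [pow_succ] at hu; linarith)
        rw [F1 u ⟨a, hh⟩]
        rw [Real.mul_rpow (by norm_num) a] at this
        have e : u ^ θ = r * (2 ^ θ * u ^ θ) := by rw [← mul_assoc, hr, one_mul]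
        rw [e]
        constructor
        · have := mul_le_mul_of_nonneg_left this.1 hr0; linarith
        · have := mul_le_mul_of_nonneg_left this.2 hr0; linarith
      · exact big u ⟨hh, b⟩
  rintro u ⟨a, b⟩
  rcases a.eq_or_lt with a' | a'
  · subst a'
    rw [F0, Real.zero_rpow (by linarith)]; simp
  · obtain ⟨n, hn⟩ := pow_unbounded_of_one_lt (1 / u) (one_lt_two)
    refine main n u ⟨a, b⟩ ?_
    rw [div_lt_iff₀ a'] at hn
    exact hn.le

theorem complex_curve (θ : ℝ) (hθ1 : 1 / 2 < θ) (hθ2 : θ ≤ 1) :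
    ∃ (c C : ℝ) (g : ℝ → ℂ), 0 < c ∧ 0 < C ∧
      ∀ s ∈ Set.Icc (0 : ℝ) 1, ∀ t ∈ Set.Icc (0 : ℝ) 1, s < t →
        c * (t - s) ^ θ ≤ ‖g s - g t‖ ∧ ‖g s - g t‖ ≤ C * (t - s) ^ θ := by
  set r : ℝ := ((2 : ℝ) ^ θ)⁻¹ with hrdef
  have p0 : (0 : ℝ) < 2 ^ θ := by positivity
  have hr : r * 2 ^ θ = 1 := inv_mul_cancel₀ p0.ne'
  have r0 : 0 < r := inv_pos.mpr p0
  have p1 : (2 : ℝ) ^ θ ≤ 2 := by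
    calc (2 : ℝ) ^ θ ≤ 2 ^ (1 : ℝ) := Real.rpow_le_rpow_of_exponent_le (by norm_num) hθ2
      _ = 2 := Real.rpow_one 2
  have p2 : 2 < ((2 : ℝ) ^ θ) ^ 2 := by
    rw [← Real.rpow_natCast, ← Real.rpow_mul (by norm_num)]
    calc (2 : ℝ) = 2 ^ (1 : ℝ) := (Real.rpow_one 2).symm
      _ < _ := Real.rpow_lt_rpow_of_exponent_lt (by norm_num) (by push_cast; linarith)
  have r1 : 1 / 2 ≤ r := by nlinarith
  have r2 : r ^ 2 < 1 / 2 := by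
    have : r ^ 2 * ((2 : ℝ) ^ θ) ^ 2 = 1 := by rw [← mul_pow, hr, one_pow]
    have : 0 < r ^ 2 := by positivity
    nlinarith
  set h : ℝ := √(r ^ 2 - 1 / 4) with hdef
  have h0 : 0 ≤ h := Real.sqrt_nonneg _
  have hsq : h ^ 2 = r ^ 2 - 1 / 4 := Real.sq_sqrt (by nlinarith)
  have h1 : h < 1 / 2 := by nlinarith
  have hrh : r ^ 2 = 1 / 4 + h ^ 2 := by linarith
  obtain ⟨g, g0, g1, gT, gL, gR⟩ := exists_limit h r h0 h1 r0.le (by nlinarith) hrh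
  set c : ℝ := (1 / 2 - 2 * h ^ 2) / 2 with hc
  have cp : 0 < c := by rw [hc]; nlinarith
  have sc : ∀ u : ℝ, 0 ≤ u → u ^ θ = r * (2 * u) ^ θ := by
    intro u hu
    rw [Real.mul_rpow (by norm_num) hu, ← mul_assoc, hr, one_mul]
  have cL : ∀ t ∈ Set.Icc (0 : ℝ) (1 / 2), (g t).im ≤ h ∧ c * (h - (g t).im) ≤ 1 / 2 - (g t).re := by
    rintro t ⟨a, b⟩
    rw [gL t ⟨a, b⟩]
    exact cone_fL h c h0 h1 hc _ (gT _ ⟨by linarith, by linarith⟩)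
  have cR : ∀ t ∈ Set.Icc (1 / 2 : ℝ) 1, (g t).im ≤ h ∧ c * (h - (g t).im) ≤ (g t).re - 1 / 2 := by
    rintro t ⟨a, b⟩
    rw [gR t ⟨a, b⟩]
    exact cone_fR h c h0 h1 hc _ (gT _ ⟨by linarith, by linarith⟩)
  have fL0 : fL h 0 = 0 := by apply Complex.ext <;> simp [fL]
  have fR1 : fR h 1 = 1 := by apply Complex.ext <;> norm_num [fR]
  have fL1 : fL h 1 = ⟨1 / 2, h⟩ := by apply Complex.ext <;> norm_num [fL]
  have fR0 : fR h 0 = ⟨1 / 2, h⟩ := by apply Complex.ext <;> norm_num [fR]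
  have S0 := scaling θ r hθ1 hθ2 hr (fun u => ‖g u‖) (by simp [g0])
    (by
      rintro u hu
      have := norm_fL h r r0.le hrh (g (2 * u)) 0
      rw [fL0, sub_zero, sub_zero, ← gL u hu] at this
      exact this)
    (by
      rintro u hu
      refine ⟨?_, (tri_norm h h0 h1 _ (gT u ⟨by linarith [hu.1], hu.2⟩)).1⟩
      obtain ⟨e1, e2⟩ := cR u hu
      have : 0 ≤ c * (h - (g u).im) := mul_nonneg cp.le (by linarith)
      exact le_trans (by linarith) (Complex.re_le_norm (g u)))
  have S1 := scaling θ r hθ1 hθ2 hr (fun u => ‖1 - g (1 - u)‖) (by simp [g1])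
    (by
      rintro u ⟨a, b⟩
      have := norm_fR h r r0.le hrh 1 (g (2 * (1 - u) - 1))
      rw [fR1, ← gR (1 - u) ⟨by linarith, by linarith⟩] at this
      simp only [this]
      congr 4; ring)
    (by
      rintro u ⟨a, b⟩
      refine ⟨?_, (tri_norm h h0 h1 _ (gT (1 - u) ⟨by linarith, by linarith⟩)).2⟩
      obtain ⟨e1, e2⟩ := cL (1 - u) ⟨by linarith, by linarith⟩
      have : 0 ≤ c * (h - (g (1 - u)).im) := mul_nonneg cp.le (by linarith)
      refine le_trans ?_ (Complex.re_le_norm (1 - g (1 - u)))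
      simp only [Complex.sub_re, Complex.one_re]
      linarith)
  set A : ℂ := ⟨1 / 2, h⟩ with hA
  -- distances to the apex
  have DL : ∀ s ∈ Set.Icc (0 : ℝ) (1 / 2),
      1 / 2 * (1 / 2 - s) ^ θ ≤ ‖g s - A‖ ∧ ‖g s - A‖ ≤ 4 * (1 / 2 - s) ^ θ := by
    rintro s ⟨a, b⟩
    have e := norm_fL h r r0.le hrh (g (2 * s)) 1
    rw [fL1, ← gL s ⟨a, b⟩, norm_sub_rev _ 1] at e
    have k := S1 (1 - 2 * s) ⟨by linarith, by linarith⟩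
    rw [show 1 - (1 - 2 * s) = 2 * s by ring] at k
    rw [e, sc (1 / 2 - s) (by linarith), show 2 * (1 / 2 - s) = 1 - 2 * s by ring]
    constructor
    · have := mul_le_mul_of_nonneg_left k.1 r0.le; linarith
    · have := mul_le_mul_of_nonneg_left k.2 r0.le; linarith
  have DR : ∀ s ∈ Set.Icc (1 / 2 : ℝ) 1,
      1 / 2 * (s - 1 / 2) ^ θ ≤ ‖g s - A‖ ∧ ‖g s - A‖ ≤ 4 * (s - 1 / 2) ^ θ := by
    rintro s ⟨a, b⟩
    have e := norm_fR h r r0.le hrh (g (2 * s - 1)) 0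
    rw [fR0, ← gR s ⟨a, b⟩, sub_zero] at e
    have k := S0 (2 * s - 1) ⟨by linarith, by linarith⟩
    rw [e, sc (s - 1 / 2) (by linarith), show 2 * (s - 1 / 2) = 2 * s - 1 by ring]
    constructor
    · have := mul_le_mul_of_nonneg_left k.1 r0.le; linarith
    · have := mul_le_mul_of_nonneg_left k.2 r0.le; linarith
  have mid : ∀ s ∈ Set.Icc (0 : ℝ) (1 / 2), ∀ t ∈ Set.Icc (1 / 2 : ℝ) 1,
      c / (1 + c) / 2 * (t - s) ^ θ ≤ ‖g s - g t‖ ∧ ‖g s - g t‖ ≤ 8 * (t - s) ^ θ := by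
    rintro s ⟨sa, sb⟩ t ⟨ta, tb⟩
    have kL := DL s ⟨sa, sb⟩
    have kR := DR t ⟨ta, tb⟩
    constructor
    · have sub : (t - s) ^ θ ≤ (1 / 2 - s) ^ θ + (t - 1 / 2) ^ θ := by
        have := Real.rpow_add_le_add_rpow (p := θ) (a := 1 / 2 - s) (b := t - 1 / 2)
          (by linarith) (by linarith) (by linarith) hθ2
        rwa [show 1 / 2 - s + (t - 1 / 2) = t - s by ring] at this
      obtain ⟨a1, a2⟩ := cL s ⟨sa, sb⟩
      obtain ⟨b1, b2⟩ := cR t ⟨ta, tb⟩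
      have q1 : 0 ≤ c * (h - (g s).im) := mul_nonneg cp.le (by linarith)
      have q2 : 0 ≤ c * (h - (g t).im) := mul_nonneg cp.le (by linarith)
      have n1 : ‖g s - A‖ ≤ (1 / 2 - (g s).re) + (h - (g s).im) := by
        rw [norm_sub_rev]
        refine (Complex.norm_le_abs_re_add_abs_im _).trans ?_
        simp only [Complex.sub_re, Complex.sub_im, hA]
        rw [abs_of_nonneg (by linarith), abs_of_nonneg (by linarith)]
      have n2 : ‖g t - A‖ ≤ ((g t).re - 1 / 2) + (h - (g t).im) := by
        refine (Complex.norm_le_abs_re_add_abs_im _).trans ?_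
        simp only [Complex.sub_re, Complex.sub_im, hA]
        rw [abs_of_nonneg (by linarith), abs_of_nonpos (by linarith)]
        linarith
      have n3 : (g t).re - (g s).re ≤ ‖g s - g t‖ := by
        rw [norm_sub_rev]
        simpa using Complex.re_le_norm (g t - g s)
      rw [div_div, div_mul_eq_mul_div, div_le_iff₀ (by positivity)]
      have w1 := mul_le_mul_of_nonneg_left n1 cp.le
      have w2 := mul_le_mul_of_nonneg_left n2 cp.le
      have w3 := mul_le_mul_of_nonneg_left sub cp.le
      have w4 := mul_le_mul_of_nonneg_left kL.1 cp.le
      have w5 := mul_le_mul_of_nonneg_left kR.1 cp.le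
      have w6 := mul_le_mul_of_nonneg_left n3 cp.le
      linarith
    · have m1 : (1 / 2 - s) ^ θ ≤ (t - s) ^ θ :=
        Real.rpow_le_rpow (by linarith) (by linarith) (by linarith)
      have m2 : (t - 1 / 2) ^ θ ≤ (t - s) ^ θ :=
        Real.rpow_le_rpow (by linarith) (by linarith) (by linarith)
      have := norm_sub_le_norm_sub_add_norm_sub (g s) A (g t)
      rw [norm_sub_rev A] at this
      linarith
  refine ⟨c / (1 + c) / 2, 8, g, by positivity, by norm_num, ?_⟩
  set c' := c / (1 + c) / 2
  have main : ∀ n : ℕ, ∀ s ∈ Set.Icc (0 : ℝ) 1, ∀ t ∈ Set.Icc (0 : ℝ) 1, s < t →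
      1 ≤ 2 ^ n * (t - s) →
        c' * (t - s) ^ θ ≤ ‖g s - g t‖ ∧ ‖g s - g t‖ ≤ 8 * (t - s) ^ θ := by
    intro n
    induction n with
    | zero =>
      rintro s ⟨sa, sb⟩ t ⟨ta, tb⟩ hst hn
      simp at hn
      exact mid s ⟨sa, by linarith⟩ t ⟨by linarith, tb⟩
    | succ n ih =>
      rintro s ⟨sa, sb⟩ t ⟨ta, tb⟩ hst hn
      rw [pow_succ] at hn
      rcases le_total t (1 / 2) with ht | ht
      · have k := ih (2 * s) ⟨by linarith, by linarith⟩ (2 * t) ⟨by linarith, by linarith⟩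
          (by linarith) (by linarith)
        rw [gL s ⟨sa, by linarith⟩, gL t ⟨ta, ht⟩, norm_fL h r r0.le hrh,
          sc (t - s) (by linarith), show 2 * (t - s) = 2 * t - 2 * s by ring]
        constructor
        · have := mul_le_mul_of_nonneg_left k.1 r0.le; linarith
        · have := mul_le_mul_of_nonneg_left k.2 r0.le; linarith
      · rcases le_total s (1 / 2) with hs | hs
        · exact mid s ⟨sa, hs⟩ t ⟨ht, tb⟩
        · have k := ih (2 * s - 1) ⟨by linarith, by linarith⟩ (2 * t - 1)
            ⟨by linarith, by linarith⟩ (by linarith) (by linarith)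
          rw [gR s ⟨hs, sb⟩, gR t ⟨ht, tb⟩, norm_fR h r r0.le hrh,
            sc (t - s) (by linarith), show 2 * (t - s) = 2 * t - 1 - (2 * s - 1) by ring]
          constructor
          · have := mul_le_mul_of_nonneg_left k.1 r0.le; linarith
          · have := mul_le_mul_of_nonneg_left k.2 r0.le; linarith
  intro s hs t ht hst
  obtain ⟨n, hn⟩ := pow_unbounded_of_one_lt (1 / (t - s)) (one_lt_two)
  rw [div_lt_iff₀ (by linarith)] at hn
  exact main n s hs t ht hst hn.le

/-- **Existence of bi-Hölder snowflake-type curves** (Lemma 3.4). For every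
`θ ∈ (1/2, 1]` there are a constant `C > 0` and a curve `g : [0,1] → ℝ²` with
`C⁻¹|s-t|^θ ≤ |g(s)-g(t)| ≤ C|s-t|^θ` for all `s, t ∈ [0,1]`. -/
theorem exists_biHolder_curve (θ : ℝ) (hθ1 : 1 / 2 < θ) (hθ2 : θ ≤ 1) :
    ∃ (C : ℝ) (g : ℝ → E2), 0 < C ∧
      ∀ s ∈ Set.Icc (0 : ℝ) 1, ∀ t ∈ Set.Icc (0 : ℝ) 1,
        C⁻¹ * |s - t| ^ θ ≤ ‖g s - g t‖ ∧ ‖g s - g t‖ ≤ C * |s - t| ^ θ := by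
  obtain ⟨c, C, g, hc, hC, H⟩ := complex_curve θ hθ1 hθ2
  have key : ∀ s ∈ Set.Icc (0 : ℝ) 1, ∀ t ∈ Set.Icc (0 : ℝ) 1,
      c * |s - t| ^ θ ≤ ‖g s - g t‖ ∧ ‖g s - g t‖ ≤ C * |s - t| ^ θ := by
    intro s hs t ht
    rcases lt_trichotomy s t with hst | hst | hst
    · rw [abs_sub_comm, abs_of_pos (sub_pos.mpr hst)]
      exact H s hs t ht hst
    · subst hst
      simp [Real.zero_rpow (show θ ≠ 0 by linarith)]
    · rw [abs_of_pos (sub_pos.mpr hst), norm_sub_rev]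
      exact H t ht s hs hst
  refine ⟨max C c⁻¹, fun t => Complex.orthonormalBasisOneI.repr (g t),
    lt_max_of_lt_left hC, ?_⟩
  intro s hs t ht
  have e : ‖Complex.orthonormalBasisOneI.repr (g s) - Complex.orthonormalBasisOneI.repr (g t)‖
      = ‖g s - g t‖ := by
    rw [← map_sub, LinearIsometryEquiv.norm_map]
  simp only
  rw [e]
  have hp : 0 ≤ |s - t| ^ θ := by positivity
  obtain ⟨k1, k2⟩ := key s hs t ht
  constructor
  · refine le_trans (mul_le_mul_of_nonneg_right ?_ hp) k1
    exact inv_le_of_inv_le₀ hc (le_max_right _ _)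
  · exact k2.trans (mul_le_mul_of_nonneg_right (le_max_left _ _) hp)

end DFA
end
end
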